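/- arXiv:2601.14193 — 2 statements merged into one kernel-verified Lean document; each statement's English description precedes it below -/
import Mathlib

section
/- Every translation invariant continuous valuation φ on ℝⁿ can be written uniquely as φ = φ₀ + φ₁ + ⋯ + φₙ, where each φᵢ is a translation invariant continuous valuation homogeneous of degree i. Uniqueness means: if φ₀ + ⋯ + φₙ = ψ₀ + ⋯ + ψₙ with φᵢ and ψᵢ translation invariant continuous valuations homogeneous of degree i, then φᵢ = ψᵢ for every i. -/
open MeasureTheory Metric Filter Topology
open scoped Pointwise

/-- ℝⁿ as Euclidean space. -/
abbrev Rn (n : ℕ) := EuclideanSpace ℝ (Fin n)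

/-- A convex body: a nonempty compact convex subset of ℝⁿ. -/
def IsConvexBody {n : ℕ} (K : Set (Rn n)) : Prop :=
  K.Nonempty ∧ IsCompact K ∧ Convex ℝ K

/-- A translation invariant continuous valuation on the convex bodies of ℝⁿ. -/
structure TIValuation (n : ℕ) where
  /-- the value of the valuation on a convex body -/
  val : Set (Rn n) → ℂ
  continuity : ∀ (Ki : ℕ → Set (Rn n)) (K : Set (Rn n)), (∀ i, IsConvexBody (Ki i)) →
    IsConvexBody K → Tendsto (fun i => hausdorffDist (Ki i) K) atTop (𝓝 0) →
    Tendsto (fun i => val (Ki i)) atTop (𝓝 (val K))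
  translation_invariant : ∀ K : Set (Rn n), IsConvexBody K → ∀ x : Rn n,
    val ((fun y => y + x) '' K) = val K
  valuation : ∀ K L : Set (Rn n), IsConvexBody K → IsConvexBody L → IsConvexBody (K ∪ L) →
    val (K ∪ L) + val (K ∩ L) = val K + val L

/-- A translation invariant continuous valuation is homogeneous of degree `i`. -/
def TIValuation.Homogeneous {n : ℕ} (φ : TIValuation n) (i : ℕ) : Prop :=
  ∀ t : ℝ, 0 < t → ∀ K : Set (Rn n), IsConvexBody K → φ.val (t • K) = (t : ℂ) ^ i * φ.val K


open Polynomial in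
lemma poly_of_fwdDiff (f : ℕ → ℂ) (m : ℕ) (h : ∀ k, (fwdDiff 1)^[m+1] f k = 0) :
    ∃ p : Polynomial ℂ, p.natDegree ≤ m ∧ ∀ k : ℕ, f k = p.eval (k : ℂ) := by
  have h0 : ∀ j, m + 1 ≤ j → (fwdDiff 1)^[j] f 0 = 0 := by
    intro j hj
    obtain ⟨i, rfl⟩ := Nat.exists_eq_add_of_le hj
    rw [add_comm (m+1) i, Function.iterate_add_apply]
    have : (fwdDiff 1)^[m+1] f = 0 := by ext k; exact h k
    rw [this]
    have := fwdDiff_iter_eq_sum_shift (1:ℕ) (0 : ℕ → ℂ) i 0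
    simpa using this
  refine ⟨∑ k ∈ Finset.range (m+1), C ((fwdDiff 1)^[k] f 0 / (k.factorial : ℂ)) * descPochhammer ℂ k, ?_, ?_⟩
  · refine natDegree_sum_le_of_forall_le _ _ ?_
    intro k hk
    refine (natDegree_C_mul_le _ _).trans ?_
    rw [descPochhammer_natDegree]
    have := Finset.mem_range.1 hk
    omega
  · intro N
    have := shift_eq_sum_fwdDiff_iter (1:ℕ) f N 0
    simp only [smul_eq_mul, mul_one, zero_add] at this
    rw [this, eval_finsetSum]
    have e1 : ∀ k, eval (N:ℂ) (C ((fwdDiff 1)^[k] f 0 / (k.factorial : ℂ)) * descPochhammer ℂ k)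
        = N.choose k • (fwdDiff 1)^[k] f 0 := by
      intro k
      rw [eval_mul, eval_C, descPochhammer_eval_eq_descFactorial, Nat.descFactorial_eq_factorial_mul_choose]
      have : (k.factorial : ℂ) ≠ 0 := by exact_mod_cast k.factorial_ne_zero
      push_cast
      simp only [nsmul_eq_mul]
      field_simp
    simp_rw [e1]
    have hA : ∑ k ∈ Finset.range (N+1), N.choose k • (fwdDiff 1)^[k] f 0
      = ∑ k ∈ Finset.range (N+1+(m+1)), N.choose k • (fwdDiff 1)^[k] f 0 := by
      apply Finset.sum_subset
      · intro x; simp only [Finset.mem_range]; omega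
      · intro x _ hx
        simp only [Finset.mem_range] at hx
        rw [Nat.choose_eq_zero_of_lt (by omega), zero_smul]
    have hB : ∑ k ∈ Finset.range (m+1), N.choose k • (fwdDiff 1)^[k] f 0
      = ∑ k ∈ Finset.range (N+1+(m+1)), N.choose k • (fwdDiff 1)^[k] f 0 := by
      apply Finset.sum_subset
      · intro x; simp only [Finset.mem_range]; omega
      · intro x _ hx
        simp only [Finset.mem_range] at hx
        rw [h0 x (by omega), smul_zero]
    rw [hA, hB]

lemma natDegree_le_of_growth (p : Polynomial ℂ) (n : ℕ) (Cst : ℝ)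
    (h : ∀ k : ℕ, 1 ≤ k → ‖p.eval (k : ℂ)‖ ≤ Cst * (k : ℝ) ^ n) : p.natDegree ≤ n := by
  by_contra! hn
  have h1 : Tendsto (fun k : ℕ => p.reverse.eval (((k:ℂ))⁻¹)) atTop (𝓝 (p.reverse.eval 0)) := by
    have hc : Continuous (fun x : ℂ => p.reverse.eval x) := p.reverse.continuous
    exact (hc.tendsto 0).comp (tendsto_inv_atTop_nhds_zero_nat (𝕜 := ℂ))
  have h2 : Tendsto (fun k : ℕ => p.reverse.eval (((k:ℂ))⁻¹)) atTop (𝓝 0) := by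
    have h3 : Tendsto (fun k : ℕ => Cst * ((k:ℝ))⁻¹) atTop (𝓝 0) := by
      simpa using (tendsto_inv_atTop_nhds_zero_nat (𝕜 := ℝ)).const_mul Cst
    refine squeeze_zero_norm' ?_ h3
    filter_upwards [eventually_ge_atTop 1] with k hk
    have hk0 : (k:ℂ) ≠ 0 := by exact_mod_cast (by omega : k ≠ 0)
    have hk1 : (1:ℝ) ≤ k := by exact_mod_cast hk
    let _ : Invertible (k:ℂ) := invertibleOfNonzero hk0
    have e := Polynomial.eval₂_reverse_mul_pow (RingHom.id ℂ) (k:ℂ) p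
    rw [invOf_eq_inv] at e
    change Polynomial.eval _ _ * _ = Polynomial.eval _ _ at e
    have hh := h k hk
    rw [← e, norm_mul, norm_pow, Complex.norm_natCast] at hh
    obtain ⟨d, hd⟩ := Nat.exists_eq_add_of_lt hn
    rw [hd] at hh
    have hkp : (0:ℝ) < k := by linarith
    have hC : 0 ≤ Cst := by
      have := (norm_nonneg _).trans (h 1 le_rfl)
      simpa using this
    rw [← div_eq_mul_inv, le_div_iff₀ hkp]
    have hpos : (0:ℝ) < (k:ℝ)^n := by positivity
    have : ‖Polynomial.eval (k:ℂ)⁻¹ p.reverse‖ * k * (k:ℝ)^n ≤ Cst * (k:ℝ)^n := by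
      refine le_trans ?_ hh
      have : (1:ℝ) ≤ (k:ℝ)^d := one_le_pow₀ hk1
      calc ‖Polynomial.eval (k:ℂ)⁻¹ p.reverse‖ * k * (k:ℝ)^n
          = ‖Polynomial.eval (k:ℂ)⁻¹ p.reverse‖ * (k * (k:ℝ)^n) * 1 := by ring
        _ ≤ ‖Polynomial.eval (k:ℂ)⁻¹ p.reverse‖ * (k * (k:ℝ)^n) * (k:ℝ)^d := by gcongr
        _ = _ := by ring
    exact le_of_mul_le_mul_right this hpos
  have h4 := tendsto_nhds_unique h1 h2
  rw [← Polynomial.coeff_zero_eq_eval_zero, Polynomial.coeff_zero_reverse, Polynomial.leadingCoeff_eq_zero] at h4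
  simp [h4] at hn

lemma fwdDiff_of_poly (f : ℕ → ℂ) (n : ℕ) (p : Polynomial ℂ) (hp : p.natDegree ≤ n)
    (h : ∀ k : ℕ, f k = p.eval (k : ℂ)) (k : ℕ) : (fwdDiff 1)^[n+1] f k = 0 := by
  have h1 := congrFun (Polynomial.fwdDiff_iter_eq_zero_of_degree_lt (Nat.lt_succ_of_le hp)) (k:ℂ)
  rw [fwdDiff_iter_eq_sum_shift] at h1 ⊢
  simpa [h] using h1

lemma IsConvexBody.smul {n : ℕ} {K : Set (Rn n)} (hK : IsConvexBody K) (c : ℝ) :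
    IsConvexBody (c • K) :=
  ⟨hK.1.smul_set, hK.2.1.smul c, hK.2.2.smul c⟩

lemma IsConvexBody.translate {n : ℕ} {K : Set (Rn n)} (hK : IsConvexBody K) (x : Rn n) :
    IsConvexBody ((fun y => y + x) '' K) := by
  refine ⟨hK.1.image _, hK.2.1.image (by fun_prop), ?_⟩
  have := hK.2.2.translate x
  have e : (fun y => y + x) = (fun y => x + y) := by ext1 y; exact add_comm _ _
  rwa [e]

lemma exists_close {n : ℕ} {K L : Set (Rn n)} (hK : IsConvexBody K) (hL : IsConvexBody L)
    {x : Rn n} (hx : x ∈ K) : ∃ y ∈ L, dist x y ≤ hausdorffDist K L := by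
  obtain ⟨y, hy, h⟩ := hL.2.1.exists_infDist_eq_dist hL.1 x
  refine ⟨y, hy, ?_⟩
  rw [← h]
  exact infDist_le_hausdorffDist_of_mem hx
    (hausdorffEDist_ne_top_of_nonempty_of_bounded hK.1 hL.1 hK.2.1.isBounded hL.2.1.isBounded)

lemma hausdorffDist_smul_le {n : ℕ} {K L : Set (Rn n)} (hK : IsConvexBody K) (hL : IsConvexBody L)
    (c : ℝ) : hausdorffDist (c • K) (c • L) ≤ |c| * hausdorffDist K L := by
  apply hausdorffDist_le_of_mem_dist (mul_nonneg (abs_nonneg _) hausdorffDist_nonneg)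
  · rintro _ ⟨x, hx, rfl⟩
    obtain ⟨y, hy, h⟩ := exists_close hK hL hx
    refine ⟨c • y, Set.smul_mem_smul_set hy, ?_⟩
    simp only [dist_smul₀, Real.norm_eq_abs]
    gcongr
  · rintro _ ⟨x, hx, rfl⟩
    obtain ⟨y, hy, h⟩ := exists_close hL hK hx
    refine ⟨c • y, Set.smul_mem_smul_set hy, ?_⟩
    simp only [dist_smul₀, Real.norm_eq_abs]
    rw [hausdorffDist_comm]
    gcongr

lemma TIValuation.tendsto_smul {n : ℕ} (φ : TIValuation n) (Ki : ℕ → Set (Rn n)) (K : Set (Rn n))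
    (hKi : ∀ i, IsConvexBody (Ki i)) (hK : IsConvexBody K)
    (h : Tendsto (fun i => hausdorffDist (Ki i) K) atTop (𝓝 0)) (c : ℝ) :
    Tendsto (fun i => φ.val (c • Ki i)) atTop (𝓝 (φ.val (c • K))) := by
  apply φ.continuity _ _ (fun i => (hKi i).smul c) (hK.smul c)
  refine squeeze_zero (fun _ => hausdorffDist_nonneg)
    (fun i => hausdorffDist_smul_le (hKi i) hK c) ?_
  simpa using h.const_mul |c|

lemma TIValuation.tendsto_smul_real {n : ℕ} (φ : TIValuation n) (K : Set (Rn n))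
    (hK : IsConvexBody K) (u : ℕ → ℝ) (t : ℝ) (h : Tendsto u atTop (𝓝 t)) :
    Tendsto (fun i => φ.val (u i • K)) atTop (𝓝 (φ.val (t • K))) := by
  apply φ.continuity _ _ (fun i => hK.smul _) (hK.smul t)
  obtain ⟨R, hR0, hR⟩ := hK.2.1.isBounded.exists_pos_norm_le
  refine squeeze_zero (g := fun i => |u i - t| * R) (fun _ => hausdorffDist_nonneg) ?_ ?_
  · intro i
    apply hausdorffDist_le_of_mem_dist (by positivity)
    · rintro _ ⟨x, hx, rfl⟩
      refine ⟨t • x, Set.smul_mem_smul_set hx, ?_⟩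
      simp only [dist_eq_norm, ← sub_smul, norm_smul, Real.norm_eq_abs]
      gcongr; exact hR x hx
    · rintro _ ⟨x, hx, rfl⟩
      refine ⟨u i • x, Set.smul_mem_smul_set hx, ?_⟩
      simp only [dist_eq_norm, ← sub_smul, norm_smul, Real.norm_eq_abs]
      rw [abs_sub_comm]
      gcongr; exact hR x hx
  · have h1 : Tendsto (fun i => u i - t) atTop (𝓝 0) := by
      simpa using h.sub_const t
    simpa using (h1.abs).mul_const R

lemma segment_meets {E : Type*} [AddCommGroup E] [Module ℝ E] [TopologicalSpace E]
    [IsTopologicalAddGroup E] [ContinuousSMul ℝ E] {A B : Set E}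
    (hA : IsClosed A) (hB : IsClosed B) (hAB : Convex ℝ (A ∪ B)) {a b : E} (ha : a ∈ A)
    (hb : b ∈ B) : (segment ℝ a b ∩ (A ∩ B)).Nonempty := by
  have hs : segment ℝ a b ⊆ A ∪ B := hAB.segment_subset (Or.inl ha) (Or.inr hb)
  exact isPreconnected_closed_iff.1 (convex_segment a b).isPreconnected A B hA hB hs
    ⟨a, left_mem_segment ℝ a b, ha⟩ ⟨b, right_mem_segment ℝ a b, hb⟩

lemma TIValuation.image_valuation {n r : ℕ} (φ : TIValuation n)
    (π : (Fin r → ℝ) →ₗ[ℝ] Rn n) (A B : Set (Fin r → ℝ)) (hA : IsCompact A) (hB : IsCompact B)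
    (hA0 : A.Nonempty) (hB0 : B.Nonempty)
    (hAc : Convex ℝ A) (hBc : Convex ℝ B) (hAB : Convex ℝ (A ∪ B)) :
    φ.val (π '' (A ∪ B)) + φ.val (π '' (A ∩ B)) = φ.val (π '' A) + φ.val (π '' B) := by
  have hπ : Continuous π := π.continuous_of_finiteDimensional
  have e : π '' (A ∩ B) = π '' A ∩ π '' B := by
    apply Set.Subset.antisymm (Set.image_inter_subset _ _ _)
    rintro _ ⟨⟨a, ha, rfl⟩, ⟨b, hb, hab⟩⟩
    obtain ⟨c, hc, hcAB⟩ := segment_meets hA.isClosed hB.isClosed hAB ha hb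
    refine ⟨c, hcAB, ?_⟩
    obtain ⟨s, t, hs, ht, hst, rfl⟩ := hc
    rw [map_add, map_smul, map_smul, hab, ← add_smul, hst, one_smul]
  rw [e, Set.image_union]
  apply φ.valuation
  · exact ⟨hA0.image _, hA.image hπ, hAc.linear_image π⟩
  · exact ⟨hB0.image _, hB.image hπ, hBc.linear_image π⟩
  · rw [← Set.image_union]
    exact ⟨(hA0.inl).image _, (hA.union hB).image hπ, hAB.linear_image π⟩

/-- Truncated simplices. -/
def TS (r : ℕ) (k : ℝ) (U : Finset (Fin r)) (b : Fin r → ℝ) : Set (Fin r → ℝ) :=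
  {x | (∀ i, 0 ≤ x i) ∧ ∑ i, x i ≤ k ∧ ∀ i, i ∉ U → x i ≤ b i}

lemma TS_convex (r : ℕ) (k : ℝ) (U : Finset (Fin r)) (b : Fin r → ℝ) : Convex ℝ (TS r k U b) := by
  rintro x ⟨h1, h2, h3⟩ y ⟨h1', h2', h3'⟩ s t hs ht hst
  refine ⟨fun i => ?_, ?_, fun i hi => ?_⟩
  · have := h1 i; have := h1' i
    simp only [Pi.add_apply, Pi.smul_apply, smul_eq_mul]; positivity
  · simp only [Pi.add_apply, Pi.smul_apply, smul_eq_mul, Finset.sum_add_distrib, ← Finset.mul_sum]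
    calc _ ≤ s * k + t * k := by gcongr
      _ = k := by rw [← add_mul, hst, one_mul]
  · simp only [Pi.add_apply, Pi.smul_apply, smul_eq_mul]
    calc _ ≤ s * b i + t * b i := by
            have := h3 i hi
            have := h3' i hi
            gcongr
      _ = _ := by rw [← add_mul, hst, one_mul]

lemma TS_compact (r : ℕ) (k : ℝ) (U : Finset (Fin r)) (b : Fin r → ℝ) : IsCompact (TS r k U b) := by
  refine (isCompact_Icc (a := (0 : Fin r → ℝ)) (b := fun _ => k)).of_isClosed_subset ?_ ?_
  · have : TS r k U b = (⋂ i, {x : Fin r → ℝ | 0 ≤ x i}) ∩ ({x | ∑ i, x i ≤ k} ∩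
        ⋂ i, ⋂ (_ : i ∉ U), {x | x i ≤ b i}) := by
      ext x; simp [TS]
    rw [this]
    refine IsClosed.inter ?_ (IsClosed.inter ?_ ?_)
    · exact isClosed_iInter fun i => isClosed_le (by fun_prop) (by fun_prop)
    · exact isClosed_le (by fun_prop) (by fun_prop)
    · exact isClosed_iInter fun i => isClosed_iInter fun _ => isClosed_le (by fun_prop) (by fun_prop)
  · rintro x ⟨h1, h2, h3⟩
    refine ⟨h1, fun i => le_trans ?_ h2⟩
    exact Finset.single_le_sum (fun j _ => h1 j) (Finset.mem_univ i)

lemma TS_zero_mem (r : ℕ) (k : ℝ) (U : Finset (Fin r)) (b : Fin r → ℝ) (hk : 0 ≤ k)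
    (hb : ∀ i, 0 ≤ b i) : (0 : Fin r → ℝ) ∈ TS r k U b :=
  ⟨fun i => le_rfl, by simpa using hk, fun i _ => hb i⟩

/-- cut recurrence -/
lemma TS_rec {n r : ℕ} (φ : TIValuation n) (π : (Fin r → ℝ) →ₗ[ℝ] Rn n) (k : ℝ) (hk : 0 ≤ k)
    (U : Finset (Fin r)) (i : Fin r) (hi : i ∉ U) (b : Fin r → ℝ) (hb : ∀ i, 0 ≤ b i) :
    φ.val (π '' TS r (k+1) (insert i U) b) - φ.val (π '' TS r k (insert i U) b)
      = φ.val (π '' TS r (k+1) U (Function.update b i 1))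
        - φ.val (π '' TS r k U (Function.update b i 0)) := by
  have hsum : ∀ x : Fin r → ℝ, ∑ j, (x + (Pi.single i (1:ℝ) : Fin r → ℝ)) j = ∑ j, x j + 1 := by
    intro x
    simp [Finset.sum_add_distrib]
  have hπ : Continuous π := π.continuous_of_finiteDimensional
  have key : ∀ (V : Finset (Fin r)) (c : Fin r → ℝ), (∀ j, 0 ≤ c j) →
      φ.val (π '' ((fun y => y + (Pi.single i (1:ℝ) : Fin r → ℝ)) '' TS r k V c)) = φ.val (π '' TS r k V c) := by
    intro V c hc
    have := φ.translation_invariant (π '' TS r k V c)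
      ⟨⟨_, Set.mem_image_of_mem _ (TS_zero_mem r k V c hk hc)⟩, (TS_compact ..).image hπ,
        (TS_convex ..).linear_image π⟩ (π (Pi.single i 1))
    rw [← this, Set.image_image, Set.image_image]
    simp only [map_add]
  have hb1 : ∀ j, 0 ≤ Function.update b i 1 j := by
    intro j; by_cases h : j = i
    · subst h; simp
    · simp [h, hb]
  have hb0 : ∀ j, 0 ≤ Function.update b i 0 j := by
    intro j; by_cases h : j = i
    · subst h; simp
    · simp [h, hb]
  set A := TS r (k+1) U (Function.update b i 1) with hA
  set B := (fun y => y + (Pi.single i (1:ℝ) : Fin r → ℝ)) '' TS r k (insert i U) b with hB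
  have memB : ∀ (V : Finset (Fin r)) (c : Fin r → ℝ) (x : Fin r → ℝ),
      x ∈ (fun y => y + (Pi.single i (1:ℝ) : Fin r → ℝ)) '' TS r k V c ↔ x - Pi.single i 1 ∈ TS r k V c := by
    intro V c x
    constructor
    · rintro ⟨y, hy, rfl⟩; simpa using hy
    · intro h; exact ⟨_, h, by simp⟩
  have hsum' : ∀ x : Fin r → ℝ, ∑ j, (x - (Pi.single i (1:ℝ) : Fin r → ℝ)) j = ∑ j, x j - 1 := by
    intro x
    simp [Finset.sum_sub_distrib]
  have hU : A ∪ B = TS r (k+1) (insert i U) b := by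
    ext x
    rw [Set.mem_union, hB, memB]
    simp only [hA, TS, Set.mem_ofPred_eq, hsum']
    constructor
    · rintro (⟨h1, h2, h3⟩ | ⟨h1, h2, h3⟩)
      · refine ⟨h1, h2, fun j hj => ?_⟩
        simp only [Finset.mem_insert, not_or] at hj
        simpa [hj.1] using h3 j hj.2
      · refine ⟨fun j => ?_, by linarith, fun j hj => ?_⟩
        · by_cases h : j = i
          · subst h; have := h1 j; simp at this; linarith
          · simpa [h] using h1 j
        · have := h3 j hj
          simp only [Finset.mem_insert, not_or] at hj
          simpa [hj.1] using this
    · rintro ⟨h1, h2, h3⟩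
      by_cases h : x i ≤ 1
      · left
        refine ⟨h1, h2, fun j hj => ?_⟩
        by_cases h' : j = i
        · subst h'; simpa using h
        · simpa [h'] using h3 j (by simp [h', hj])
      · right
        push Not at h
        refine ⟨fun j => ?_, by linarith, fun j hj => ?_⟩
        · by_cases h' : j = i
          · subst h'; simp; linarith
          · simpa [h'] using h1 j
        · have := h3 j hj
          simp only [Finset.mem_insert, not_or] at hj
          simpa [hj.1] using this
  have hI : A ∩ B = (fun y => y + (Pi.single i (1:ℝ) : Fin r → ℝ)) '' TS r k U (Function.update b i 0) := by
    ext x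
    rw [Set.mem_inter_iff, hB, memB, memB]
    simp only [hA, TS, Set.mem_ofPred_eq, hsum']
    constructor
    · rintro ⟨⟨h1, h2, h3⟩, ⟨h1', h2', h3'⟩⟩
      refine ⟨h1', h2', fun j hj => ?_⟩
      by_cases h' : j = i
      · subst h'; have := h3 j hj; simpa using this
      · simpa [h'] using h3 j hj
    · rintro ⟨h1, h2, h3⟩
      have hxi : x i = 1 := by
        have a1 := h1 i
        have a2 := h3 i hi
        simp at a1 a2; linarith
      refine ⟨⟨fun j => ?_, by linarith, fun j hj => ?_⟩, h1, h2, fun j hj => ?_⟩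
      · by_cases h' : j = i
        · subst h'; rw [hxi]; exact zero_le_one
        · simpa [h'] using h1 j
      · by_cases h' : j = i
        · subst h'; simp [hxi]
        · simpa [h'] using h3 j hj
      · simp only [Finset.mem_insert, not_or] at hj
        simpa [hj.1] using h3 j hj.2
  have hBc : Convex ℝ B := by
    have := (TS_convex r k (insert i U) b).translate (Pi.single i 1)
    have e : (fun y : Fin r → ℝ => y + (Pi.single i (1:ℝ) : Fin r → ℝ)) = (fun y => Pi.single i 1 + y) := by
      ext1 y; exact add_comm _ _
    rwa [hB, e]
  have main := φ.image_valuation π A B (TS_compact ..)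
    ((TS_compact ..).image (by fun_prop)) ⟨0, TS_zero_mem _ _ _ _ (by linarith) hb1⟩
    ⟨_, Set.mem_image_of_mem _ (TS_zero_mem r k (insert i U) b hk hb)⟩ (TS_convex ..) hBc
    (hU ▸ TS_convex ..)
  rw [hU, hI, key _ _ hb0, key _ _ hb] at main
  linear_combination main

lemma TS_fwdDiff {n r : ℕ} (φ : TIValuation n) (π : (Fin r → ℝ) →ₗ[ℝ] Rn n)
    (U : Finset (Fin r)) : ∀ b : Fin r → ℝ, (∀ i, 0 ≤ b i) → (∀ i, b i ≤ 1) → ∀ k : ℕ,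
    (fwdDiff 1)^[U.card + 1] (fun k : ℕ => φ.val (π '' TS r ((k:ℝ) + r) U b)) k = 0 := by
  induction U using Finset.induction_on with
  | empty =>
    intro b hb hb1 k
    have : ∀ k : ℕ, TS r ((k:ℝ) + r) ∅ b = {x | (∀ i, 0 ≤ x i) ∧ ∀ i, x i ≤ b i} := by
      intro k
      ext x
      simp only [TS, Finset.notMem_empty, not_false_eq_true, forall_true_left, Set.mem_ofPred_eq]
      constructor
      · rintro ⟨h1, h2, h3⟩; exact ⟨h1, h3⟩
      · rintro ⟨h1, h3⟩; refine ⟨h1, ?_, h3⟩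
        calc ∑ i, x i ≤ ∑ i : Fin r, (1:ℝ) := Finset.sum_le_sum fun i _ => (h3 i).trans (hb1 i)
          _ = r := by simp
          _ ≤ _ := by simp
    simp only [this]
    simp [fwdDiff]
  | insert i U hi ih =>
    intro b hb hb1 k
    rw [Finset.card_insert_of_notMem hi, Function.iterate_succ_apply]
    have hu : ∀ c : ℝ, 0 ≤ c → c ≤ 1 → (∀ j, 0 ≤ Function.update b i c j) ∧ ∀ j, Function.update b i c j ≤ 1 := by
      intro c hc hc1
      constructor
      · intro j; by_cases h : j = i
        · subst h; simpa
        · simp [h, hb]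
      · intro j; by_cases h : j = i
        · subst h; simpa
        · simp [h, hb1]
    have e : fwdDiff 1 (fun k : ℕ => φ.val (π '' TS r ((k:ℝ) + r) (insert i U) b))
        = (fun k : ℕ => (fun k : ℕ => φ.val (π '' TS r ((k:ℝ) + r) U (Function.update b i 1))) (k + 1))
          + (-1 : ℂ) • (fun k : ℕ => φ.val (π '' TS r ((k:ℝ) + r) U (Function.update b i 0))) := by
      ext k
      have := TS_rec φ π ((k:ℝ) + r) (by positivity) U i hi b hb
      simp only [fwdDiff, Pi.add_apply, Pi.smul_apply, smul_eq_mul]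
      push_cast
      rw [add_right_comm, this]
      ring
    have hs := fwdDiff_iter_comp_add 1
      (fun k : ℕ => φ.val (π '' TS r ((k:ℝ) + r) U (Function.update b i 1))) 1 (U.card + 1) k
    rw [e, fwdDiff_iter_add, Pi.add_apply, hs, fwdDiff_iter_const_smul,
      Pi.smul_apply, ih _ (hu 1 zero_le_one le_rfl).1 (hu 1 zero_le_one le_rfl).2,
      ih _ (hu 0 le_rfl zero_le_one).1 (hu 0 le_rfl zero_le_one).2]
    simp

lemma limit_convex {n : ℕ} (Ls : ℕ → Set (Rn n)) (L : Set (Rn n)) (hLs : ∀ m, IsConvexBody (Ls m))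
    (hL0 : L.Nonempty) (hL : IsCompact L)
    (h : Tendsto (fun m => hausdorffDist (Ls m) L) atTop (𝓝 0)) : Convex ℝ L := by
  intro x hx y hy s t hs ht hst
  rw [hL.isClosed.mem_iff_infDist_zero hL0]
  apply le_antisymm _ infDist_nonneg
  have h2 : Tendsto (fun m => 2 * hausdorffDist (Ls m) L) atTop (𝓝 0) := by
    simpa using h.const_mul 2
  refine ge_of_tendsto' h2 fun m => ?_
  have hne : hausdorffEDist (Ls m) L ≠ ⊤ := hausdorffEDist_ne_top_of_nonempty_of_bounded
    (hLs m).1 hL0 (hLs m).2.1.isBounded hL.isBounded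
  have hne' : hausdorffEDist L (Ls m) ≠ ⊤ := by rwa [hausdorffEDist_comm]
  obtain ⟨x', hx', ex⟩ := (hLs m).2.1.exists_infDist_eq_dist (hLs m).1 x
  obtain ⟨y', hy', ey⟩ := (hLs m).2.1.exists_infDist_eq_dist (hLs m).1 y
  have dx : dist x x' ≤ hausdorffDist (Ls m) L := by
    rw [← ex, hausdorffDist_comm]; exact infDist_le_hausdorffDist_of_mem hx hne'
  have dy : dist y y' ≤ hausdorffDist (Ls m) L := by
    rw [← ey, hausdorffDist_comm]; exact infDist_le_hausdorffDist_of_mem hy hne'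
  have hz := (hLs m).2.2 hx' hy' hs ht hst
  have dz := infDist_le_hausdorffDist_of_mem hz hne
  have d1 : dist (s • x + t • y) (s • x' + t • y') ≤ hausdorffDist (Ls m) L := by
    calc _ ≤ dist (s • x) (s • x') + dist (t • y) (t • y') := dist_add_add_le _ _ _ _
      _ = s * dist x x' + t * dist y y' := by
        rw [dist_smul₀, dist_smul₀, Real.norm_of_nonneg hs, Real.norm_of_nonneg ht]
      _ ≤ s * hausdorffDist (Ls m) L + t * hausdorffDist (Ls m) L := by gcongr
      _ = _ := by rw [← add_mul, hst, one_mul]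
  have := infDist_le_infDist_add_dist (s := L) (x := s • x + t • y) (y := s • x' + t • y')
  linarith

lemma TIValuation.bounded_cube {n : ℕ} (φ : TIValuation n) : ∃ C : ℝ, ∀ L : Set (Rn n),
    IsConvexBody L → (∀ x ∈ L, ∀ i, 0 ≤ x i ∧ x i ≤ 1) → ‖φ.val L‖ ≤ C := by
  by_contra! hcon
  choose Ls hLs hcube hbig using fun m : ℕ => hcon m
  have hQ : IsCompact {x : Rn n | ∀ i, 0 ≤ x i ∧ x i ≤ 1} := by
    refine Metric.isCompact_of_isClosed_isBounded ?_ ?_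
    · have : {x : Rn n | ∀ i, 0 ≤ x i ∧ x i ≤ 1} = ⋂ i, ({x : Rn n | 0 ≤ x i} ∩ {x | x i ≤ 1}) := by
        ext x; simp
      rw [this]
      exact isClosed_iInter fun i => (isClosed_le (by fun_prop) (by fun_prop)).inter
        (isClosed_le (by fun_prop) (by fun_prop))
    · rw [isBounded_iff_forall_norm_le]
      refine ⟨√ (n : ℝ), fun x hx => ?_⟩
      rw [EuclideanSpace.norm_eq]
      apply Real.sqrt_le_sqrt
      calc ∑ i, ‖x i‖ ^ 2 ≤ ∑ i : Fin n, (1:ℝ) := by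
            apply Finset.sum_le_sum
            intro i _
            rw [Real.norm_of_nonneg (hx i).1]
            have := (hx i).1; have := (hx i).2
            nlinarith
        _ = n := by simp
  let N : ℕ → TopologicalSpace.NonemptyCompacts (Rn n) := fun m => ⟨⟨Ls m, (hLs m).2.1⟩, (hLs m).1⟩
  obtain ⟨L, -, ψ, hψ, hlim⟩ :=
    (TopologicalSpace.NonemptyCompacts.isCompact_subsets_of_isCompact hQ).tendsto_subseq
      (x := N) (fun m => hcube m)
  have hd : Tendsto (fun m => hausdorffDist (Ls (ψ m)) (L : Set (Rn n))) atTop (𝓝 0) := by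
    have := tendsto_iff_dist_tendsto_zero.1 hlim
    exact this
  have hLb : IsConvexBody (L : Set (Rn n)) :=
    ⟨L.nonempty, L.isCompact, limit_convex _ _ (fun m => hLs (ψ m)) L.nonempty L.isCompact hd⟩
  have hc := (φ.continuity _ _ (fun m => hLs (ψ m)) hLb hd).norm
  have ht : Tendsto (fun m => ‖φ.val (Ls (ψ m))‖) atTop atTop := by
    refine tendsto_atTop_mono (fun m => (hbig (ψ m)).le) ?_
    exact tendsto_natCast_atTop_atTop.comp hψ.tendsto_atTop
  exact not_tendsto_nhds_of_tendsto_atTop ht _ hc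

lemma TIValuation.cut {n : ℕ} (φ : TIValuation n) (L : Set (Rn n)) (hL : IsConvexBody L)
    (i : Fin n) (c : ℝ) (h1 : (L ∩ {x | x i ≤ c}).Nonempty) (h2 : (L ∩ {x | c ≤ x i}).Nonempty) :
    IsConvexBody (L ∩ {x | x i ≤ c}) ∧ IsConvexBody (L ∩ {x | c ≤ x i}) ∧
    IsConvexBody (L ∩ {x | x i = c}) ∧ φ.val L + φ.val (L ∩ {x | x i = c})
      = φ.val (L ∩ {x | x i ≤ c}) + φ.val (L ∩ {x | c ≤ x i}) := by
  have lin : IsLinearMap ℝ (fun x : Rn n => x i) := ⟨fun _ _ => rfl, fun _ _ => rfl⟩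
  have b1 : IsConvexBody (L ∩ {x | x i ≤ c}) :=
    ⟨h1, hL.2.1.inter_right (isClosed_le (by fun_prop) (by fun_prop)),
      hL.2.2.inter (convex_halfSpace_le lin c)⟩
  have b2 : IsConvexBody (L ∩ {x | c ≤ x i}) :=
    ⟨h2, hL.2.1.inter_right (isClosed_le (by fun_prop) (by fun_prop)),
      hL.2.2.inter (convex_halfSpace_ge lin c)⟩
  have eU : (L ∩ {x | x i ≤ c}) ∪ (L ∩ {x | c ≤ x i}) = L := by
    ext x
    constructor
    · rintro (h | h) <;> exact h.1
    · intro h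
      rcases le_total (x i) c with h' | h'
      · exact Or.inl ⟨h, h'⟩
      · exact Or.inr ⟨h, h'⟩
  have eI : (L ∩ {x | x i ≤ c}) ∩ (L ∩ {x | c ≤ x i}) = L ∩ {x | x i = c} := by
    ext x
    constructor
    · rintro ⟨⟨h, h'⟩, ⟨_, h''⟩⟩; exact ⟨h, le_antisymm h' h''⟩
    · rintro ⟨h, h'⟩; exact ⟨⟨h, le_of_eq h'⟩, ⟨h, le_of_eq h'.symm⟩⟩
  have b3 : IsConvexBody (L ∩ {x | x i = c}) := by
    rw [← eI]
    obtain ⟨a, ha⟩ := h1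
    obtain ⟨b, hb⟩ := h2
    obtain ⟨z, -, hz⟩ := segment_meets b1.2.1.isClosed b2.2.1.isClosed (eU.symm ▸ hL.2.2) ha hb
    exact ⟨⟨z, hz⟩, b1.2.1.inter b2.2.1, b1.2.2.inter b2.2.2⟩
  refine ⟨b1, b2, b3, ?_⟩
  have := φ.valuation _ _ b1 b2 (eU.symm ▸ hL)
  rwa [eU, eI] at this

lemma TIValuation.growth_aux {n : ℕ} (φ : TIValuation n) (S : Finset (Fin n)) :
    ∃ C : ℝ, 0 ≤ C ∧ ∀ k : ℕ, 1 ≤ k → ∀ L : Set (Rn n), IsConvexBody L → ∀ a : Fin n → ℝ,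
      (∀ x ∈ L, ∀ i, a i ≤ x i ∧ x i ≤ a i + (if i ∈ S then (k:ℝ) else 1)) →
      ‖φ.val L‖ ≤ C * (k:ℝ) ^ S.card := by
  induction S using Finset.induction_on with
  | empty =>
    obtain ⟨C, hC⟩ := φ.bounded_cube
    refine ⟨max C 0, le_max_right _ _, fun k hk L hL a ha => ?_⟩
    rw [← φ.translation_invariant L hL (WithLp.toLp 2 (-a))]
    simp only [Finset.card_empty, pow_zero, mul_one]
    refine (hC _ (hL.translate _) ?_).trans (le_max_left _ _)
    rintro _ ⟨x, hx, rfl⟩ i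
    have := ha x hx i
    simp at this ⊢
    constructor <;> linarith
  | insert i S hi ih =>
    obtain ⟨C, hC0, hC⟩ := ih
    refine ⟨3 * C, by positivity, fun k hk L hL a ha => ?_⟩
    have key : ∀ j : ℕ, ∀ L : Set (Rn n), IsConvexBody L → ∀ a : Fin n → ℝ,
      (∀ x ∈ L, ∀ l, a l ≤ x l ∧ x l ≤ a l + (if l = i then ((j:ℝ) + 1) else if l ∈ S then (k:ℝ) else 1)) →
      ‖φ.val L‖ ≤ (2 * (j:ℝ) + 1) * (C * (k:ℝ) ^ S.card) := by
      intro j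
      induction j with
      | zero =>
        intro L hL a ha
        have := hC k hk L hL a ?_
        · simpa using this
        · intro x hx l
          have h := ha x hx l
          by_cases hl : l = i
          · subst hl; simpa [hi] using h
          · simpa [hl] using h
      | succ j ihj =>
        intro L hL a ha
        have hCk : 0 ≤ C * (k:ℝ) ^ S.card := by positivity
        have hpiece : ∀ M : Set (Rn n), IsConvexBody M → M ⊆ L → (∀ x ∈ M, a i + ((j:ℝ) + 1) ≤ x i) →
            ‖φ.val M‖ ≤ C * (k:ℝ) ^ S.card := by
          intro M hM hML hMi
          refine hC k hk M hM (Function.update a i (a i + (j + 1))) ?_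
          intro x hx l
          have h := ha x (hML hx) l
          by_cases hl : l = i
          · subst hl
            have h' := hMi x hx
            simp [hi] at h ⊢
            exact ⟨h', by linarith⟩
          · simpa [hl] using h
        have hlow : ∀ M : Set (Rn n), IsConvexBody M → M ⊆ L → (∀ x ∈ M, x i ≤ a i + ((j:ℝ) + 1)) →
            ‖φ.val M‖ ≤ (2 * (j:ℝ) + 1) * (C * (k:ℝ) ^ S.card) := by
          intro M hM hML hMi
          refine ihj M hM a ?_
          intro x hx l
          have h := ha x (hML hx) l
          by_cases hl : l = i
          · subst hl
            have h' := hMi x hx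
            simp at h ⊢
            exact ⟨h.1, h'⟩
          · simpa [hl] using h
        push_cast
        by_cases h1 : (L ∩ {x | x i ≤ a i + ((j:ℝ) + 1)}).Nonempty
        · by_cases h2 : (L ∩ {x | a i + ((j:ℝ) + 1) ≤ x i}).Nonempty
          · obtain ⟨b1, b2, b3, e⟩ := φ.cut L hL i _ h1 h2
            have e' : φ.val L = φ.val (L ∩ {x | x i ≤ a i + ((j:ℝ) + 1)})
              + φ.val (L ∩ {x | a i + ((j:ℝ) + 1) ≤ x i}) - φ.val (L ∩ {x | x i = a i + ((j:ℝ) + 1)}) := by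
              linear_combination e
            rw [e']
            have n1 := hlow _ b1 Set.inter_subset_left (fun x hx => hx.2)
            have n2 := hpiece _ b2 Set.inter_subset_left (fun x hx => hx.2)
            have n3 := hpiece _ b3 Set.inter_subset_left (fun x hx => le_of_eq hx.2.symm)
            have t1 := norm_sub_le (φ.val (L ∩ {x | x i ≤ a i + ((j:ℝ) + 1)})
              + φ.val (L ∩ {x | a i + ((j:ℝ) + 1) ≤ x i})) (φ.val (L ∩ {x | x i = a i + ((j:ℝ) + 1)}))
            have t2 := norm_add_le (φ.val (L ∩ {x | x i ≤ a i + ((j:ℝ) + 1)}))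
              (φ.val (L ∩ {x | a i + ((j:ℝ) + 1) ≤ x i}))
            linarith
          · have := hlow L hL subset_rfl fun x hx => by
              by_contra! hh
              exact h2 ⟨x, hx, hh.le⟩
            linarith
        · have := hpiece L hL subset_rfl fun x hx => by
              by_contra! hh
              exact h1 ⟨x, hx, hh.le⟩
          have : 0 ≤ (j:ℝ) * (C * (k:ℝ) ^ S.card) := by positivity
          linarith
    have hk1 : (1:ℝ) ≤ k := by exact_mod_cast hk
    have := key k L hL a ?_
    · rw [Finset.card_insert_of_notMem hi]
      refine this.trans ?_
      calc (2 * (k:ℝ) + 1) * (C * (k:ℝ) ^ S.card) ≤ (3 * (k:ℝ)) * (C * (k:ℝ) ^ S.card) := by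
            gcongr; linarith
        _ = _ := by ring
    · intro x hx l
      have h := ha x hx l
      by_cases hl : l = i
      · subst hl
        simp at h ⊢
        exact ⟨h.1, by linarith⟩
      · simpa [hl] using h

lemma TIValuation.growth {n : ℕ} (φ : TIValuation n) (K : Set (Rn n)) (hK : IsConvexBody K) :
    ∃ C : ℝ, ∀ k : ℕ, 1 ≤ k → ‖φ.val ((k:ℝ) • K)‖ ≤ C * (k:ℝ) ^ n := by
  obtain ⟨C, hC0, hC⟩ := φ.growth_aux Finset.univ
  obtain ⟨R, hR0, hR⟩ := hK.2.1.isBounded.exists_pos_norm_le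
  obtain ⟨M, hM⟩ := exists_nat_ge (2 * R)
  have hM1 : 1 ≤ M := by
    have : (0:ℝ) < M := by linarith
    exact_mod_cast this
  refine ⟨C * (M:ℝ) ^ n, fun k hk => ?_⟩
  have := hC (k * M) (Nat.mul_pos hk hM1) _ (hK.smul k) (fun _ => - (k * R)) ?_
  · simpa [mul_pow, mul_assoc, mul_comm, mul_left_comm] using this
  · rintro _ ⟨x, hx, rfl⟩ i
    have h1 : |x i| ≤ R := by
      have := PiLp.norm_apply_le x i
      rw [Real.norm_eq_abs] at this
      exact this.trans (hR x hx)
    have h2 := abs_le.1 h1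
    have hk0 : (0:ℝ) ≤ k := by positivity
    simp only [PiLp.smul_apply, smul_eq_mul, Finset.mem_univ, if_true]
    push_cast
    constructor <;> nlinarith

lemma TS_scale (r : ℕ) (c : ℝ) (hc : 0 < c) : TS r c Finset.univ 0 = c • TS r 1 Finset.univ 0 := by
  ext x
  rw [Set.mem_smul_set_iff_inv_smul_mem₀ hc.ne']
  simp only [TS, Set.mem_ofPred_eq, Finset.mem_univ, not_true_eq_false, false_imp_iff,
    implies_true, and_true, Pi.smul_apply, smul_eq_mul, ← Finset.mul_sum]
  refine and_congr (forall_congr' fun i => ?_) ?_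
  · rw [mul_nonneg_iff_of_pos_left (inv_pos.2 hc)]
  · rw [inv_mul_le_iff₀ hc, mul_one]

lemma TIValuation.poly_polytope {n r : ℕ} (φ : TIValuation n) (π : (Fin r → ℝ) →ₗ[ℝ] Rn n) :
    ∃ p : Polynomial ℂ, p.natDegree ≤ n ∧ ∀ k : ℕ, 1 ≤ k →
      φ.val ((k:ℝ) • (π '' TS r 1 Finset.univ 0)) = p.eval (k:ℂ) := by
  set ρ : (Fin r → ℝ) →ₗ[ℝ] Rn n := ((r:ℝ) + 1)⁻¹ • π with hρ
  obtain ⟨p, -, hp⟩ := poly_of_fwdDiff _ _ (TS_fwdDiff φ ρ Finset.univ 0 (fun _ => le_rfl)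
    (fun _ => zero_le_one))
  have hr : (0:ℝ) < (r:ℝ) + 1 := by positivity
  have hq : ∀ k : ℕ, 1 ≤ k → φ.val ((k:ℝ) • (π '' TS r 1 Finset.univ 0))
      = (p.comp (Polynomial.C ((r:ℂ) + 1) * Polynomial.X - Polynomial.C (r:ℂ))).eval (k:ℂ) := by
    intro k hk
    have hk0 : (0:ℝ) < k := by exact_mod_cast hk
    obtain ⟨m, rfl⟩ := Nat.exists_eq_add_of_le hk
    have h := hp ((r + 1) * m + 1)
    have e1 : (((r + 1) * m + 1 : ℕ) : ℝ) + r = ((r:ℝ) + 1) * ((1 + m : ℕ) : ℝ) := by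
      push_cast; ring
    have e2 : (((r + 1) * m + 1 : ℕ) : ℂ) = ((r:ℂ) + 1) * ((1 + m : ℕ) : ℂ) - r := by
      push_cast; ring
    rw [e1, e2, TS_scale _ _ (mul_pos hr hk0)] at h
    have e3 : ρ '' ((((r:ℝ) + 1) * ((1 + m : ℕ) : ℝ)) • TS r 1 Finset.univ 0)
        = ((1 + m : ℕ) : ℝ) • (π '' TS r 1 Finset.univ 0) := by
      rw [← Set.image_smul, ← Set.image_smul, Set.image_image, Set.image_image]
      congr 1
      ext1 x
      rw [hρ, LinearMap.smul_apply, map_smul, smul_smul, ← mul_assoc, inv_mul_cancel₀ hr.ne', one_mul]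
    rw [e3] at h
    rw [h]
    simp [Polynomial.eval_comp]
  refine ⟨_, ?_, hq⟩
  have hb : IsConvexBody (π '' TS r 1 Finset.univ 0) :=
    ⟨⟨_, Set.mem_image_of_mem _ (TS_zero_mem r 1 Finset.univ 0 zero_le_one (fun _ => le_rfl))⟩,
      (TS_compact ..).image π.continuous_of_finiteDimensional, (TS_convex ..).linear_image π⟩
  obtain ⟨C, hC⟩ := φ.growth _ hb
  refine natDegree_le_of_growth _ n C fun k hk => ?_
  rw [← hq k hk]
  exact hC k hk

lemma approx_polytope {n : ℕ} (K : Set (Rn n)) (hK : IsConvexBody K) (h0 : (0 : Rn n) ∈ K)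
    (ε : ℝ) (hε : 0 < ε) : ∃ (r : ℕ) (π : (Fin r → ℝ) →ₗ[ℝ] Rn n),
      hausdorffDist (π '' TS r 1 Finset.univ 0) K ≤ ε := by
  obtain ⟨t, htK, htf, hcov⟩ := hK.2.1.finite_cover_balls hε
  let e := htf.toFinset.equivFin
  let v : Fin htf.toFinset.card → Rn n := fun i => (e.symm i : Rn n)
  have hv : ∀ i, v i ∈ K := fun i => htK (htf.mem_toFinset.1 (e.symm i).2)
  refine ⟨_, Fintype.linearCombination ℝ v, ?_⟩
  apply hausdorffDist_le_of_mem_dist hε.le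
  · rintro _ ⟨x, ⟨h1, h2, -⟩, rfl⟩
    refine ⟨_, ?_, (dist_self _).trans_le hε.le⟩
    rw [Fintype.linearCombination_apply]
    rcases (Finset.sum_nonneg fun i (_ : i ∈ Finset.univ) => h1 i).eq_or_lt with hs | hs
    · have := (Finset.sum_eq_zero_iff_of_nonneg fun i _ => h1 i).1 hs.symm
      rw [Finset.sum_eq_zero]
      · exact h0
      · intro i hi; rw [this i hi, zero_smul]
    · have := hK.2.2.centerMass_mem (t := Finset.univ) (w := x) (z := v) (fun i _ => h1 i) hs (fun i _ => hv i)
      have h3 := hK.2.2.smul_mem_of_zero_mem h0 this ⟨hs.le, h2⟩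
      rwa [Finset.centerMass, smul_smul, mul_inv_cancel₀ hs.ne', one_smul] at h3
  · intro x hx
    have := hcov hx
    simp only [Set.mem_iUnion, mem_ball] at this
    obtain ⟨y, hy, hd⟩ := this
    refine ⟨y, ⟨Pi.single (e ⟨y, htf.mem_toFinset.2 hy⟩) 1, ⟨fun i => ?_, ?_, ?_⟩, ?_⟩, hd.le⟩
    · by_cases h : i = e ⟨y, htf.mem_toFinset.2 hy⟩
      · subst h; simp
      · simp [h]
    · simp
    · simp
    · simp [Fintype.linearCombination_apply_single, v]

lemma TIValuation.poly_body {n : ℕ} (φ : TIValuation n) (K : Set (Rn n)) (hK : IsConvexBody K) :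
    ∃ p : Polynomial ℂ, p.natDegree ≤ n ∧ ∀ k : ℕ, 1 ≤ k →
      φ.val ((k:ℝ) • K) = p.eval (k:ℂ) := by
  have main : ∀ K : Set (Rn n), IsConvexBody K → (0 : Rn n) ∈ K → ∀ k : ℕ,
      (fwdDiff 1)^[n+1] (fun k : ℕ => φ.val (((k + 1 : ℕ) : ℝ) • K)) k = 0 := by
    intro K hK h0 k
    choose r π hπ using fun m : ℕ => approx_polytope K hK h0 (1 / ((m:ℝ) + 1)) (by positivity)
    have hb : ∀ m, IsConvexBody (π m '' TS (r m) 1 Finset.univ 0) := fun m =>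
      ⟨⟨_, Set.mem_image_of_mem _ (TS_zero_mem (r m) 1 Finset.univ 0 zero_le_one (fun _ => le_rfl))⟩,
        (TS_compact ..).image (π m).continuous_of_finiteDimensional, (TS_convex ..).linear_image (π m)⟩
    have hd : Tendsto (fun m => hausdorffDist (π m '' TS (r m) 1 Finset.univ 0) K) atTop (𝓝 0) :=
      squeeze_zero (fun _ => hausdorffDist_nonneg) hπ tendsto_one_div_add_atTop_nhds_zero_nat
    have hz : ∀ m, (fwdDiff 1)^[n+1] (fun k : ℕ =>
        φ.val (((k + 1 : ℕ) : ℝ) • (π m '' TS (r m) 1 Finset.univ 0))) k = 0 := by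
      intro m
      obtain ⟨p, hp, hpk⟩ := φ.poly_polytope (π m)
      refine fwdDiff_of_poly _ n (p.comp (Polynomial.X + Polynomial.C 1)) ?_ ?_ k
      · rw [Polynomial.natDegree_comp, Polynomial.natDegree_X_add_C, mul_one]; exact hp
      · intro k; rw [hpk _ (by omega)]; simp [Polynomial.eval_comp]
    rw [fwdDiff_iter_eq_sum_shift]
    simp_rw [fwdDiff_iter_eq_sum_shift] at hz
    have ht : Tendsto (fun m => ∑ j ∈ Finset.range (n + 1 + 1),
        ((-1 : ℤ) ^ (n + 1 - j) * ((n + 1).choose j : ℤ)) •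
          φ.val (((k + j • 1 + 1 : ℕ) : ℝ) • (π m '' TS (r m) 1 Finset.univ 0))) atTop
        (𝓝 (∑ j ∈ Finset.range (n + 1 + 1),
        ((-1 : ℤ) ^ (n + 1 - j) * ((n + 1).choose j : ℤ)) •
          φ.val (((k + j • 1 + 1 : ℕ) : ℝ) • K))) := by
      refine tendsto_finsetSum _ fun j _ => Tendsto.const_smul ?_ _
      exact φ.tendsto_smul _ _ hb hK hd _
    simp_rw [hz] at ht
    exact tendsto_nhds_unique ht tendsto_const_nhds
  obtain ⟨x, hx⟩ := hK.1
  have hK' := hK.translate (-x)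
  obtain ⟨p, hp, hpk⟩ := poly_of_fwdDiff _ _ (main _ hK' ⟨x, hx, by simp⟩)
  refine ⟨p.comp (Polynomial.X - Polynomial.C 1), ?_, ?_⟩
  · rw [Polynomial.natDegree_comp, Polynomial.natDegree_X_sub_C, mul_one]; exact hp
  · intro k hk
    obtain ⟨m, rfl⟩ := Nat.exists_eq_add_of_le' hk
    have h := hpk m
    have e : ((m + 1 : ℕ) : ℝ) • ((fun y => y + -x) '' K)
        = (fun y => y + ((m + 1 : ℕ) : ℝ) • (-x)) '' (((m + 1 : ℕ) : ℝ) • K) := by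
      rw [← Set.image_smul, ← Set.image_smul, Set.image_image, Set.image_image]
      congr 1
      ext1 y
      rw [smul_add]
    rw [e, φ.translation_invariant _ (hK.smul _)] at h
    rw [h]
    simp [Polynomial.eval_comp]

/-- The component of degree `i`. -/
noncomputable def TIValuation.component {n : ℕ} (φ : TIValuation n) (i : ℕ) : TIValuation n where
  val K := ∑ j : Fin (n + 1), φ.val (((j : ℕ) + 1 : ℝ) • K) *
    (Lagrange.basis Finset.univ (fun j : Fin (n + 1) => ((j : ℕ) : ℂ) + 1) j).coeff i
  continuity Ki K hKi hK h := by
    refine tendsto_finsetSum _ fun j _ => Tendsto.mul_const _ ?_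
    exact φ.tendsto_smul _ _ hKi hK h _
  translation_invariant K hK x := by
    refine Finset.sum_congr rfl fun j _ => ?_
    congr 1
    have e : (((j : ℕ) : ℝ) + 1) • ((fun y => y + x) '' K)
        = (fun y => y + (((j : ℕ) : ℝ) + 1) • x) '' ((((j : ℕ) : ℝ) + 1) • K) := by
      rw [← Set.image_smul, ← Set.image_smul, Set.image_image, Set.image_image]
      congr 1
      ext1 y
      rw [smul_add]
    rw [e, φ.translation_invariant _ (hK.smul _)]
  valuation K L hK hL hKL := by
    rw [← Finset.sum_add_distrib, ← Finset.sum_add_distrib]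
    refine Finset.sum_congr rfl fun j _ => ?_
    rw [← add_mul, ← add_mul]
    congr 1
    have hj : (((j : ℕ) : ℝ) + 1) ≠ 0 := by positivity
    rw [Set.smul_set_union, Set.smul_set_inter₀ hj]
    apply φ.valuation _ _ (hK.smul _) (hL.smul _)
    rw [← Set.smul_set_union]
    exact hKL.smul _

lemma TIValuation.component_eq {n : ℕ} (φ : TIValuation n) (i : ℕ) (K : Set (Rn n))
    (p : Polynomial ℂ) (hp : p.natDegree ≤ n)
    (h : ∀ k : ℕ, 1 ≤ k → φ.val ((k:ℝ) • K) = p.eval (k:ℂ)) :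
    (φ.component i).val K = p.coeff i := by
  have hinj : Set.InjOn (fun j : Fin (n + 1) => ((j : ℕ) : ℂ) + 1) (Finset.univ : Finset (Fin (n+1))) := by
    intro a _ b _ hab
    simp only [add_left_inj, Nat.cast_inj] at hab
    exact Fin.ext hab
  have hdeg : p.degree < (Finset.univ : Finset (Fin (n+1))).card := by
    rw [Finset.card_univ, Fintype.card_fin]
    exact lt_of_le_of_lt (Polynomial.degree_le_of_natDegree_le hp) (by exact_mod_cast Nat.lt_succ_self n)
  have e := Lagrange.eq_interpolate hinj hdeg
  rw [Lagrange.interpolate_apply] at e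
  conv_rhs => rw [e]
  rw [Polynomial.finsetSum_coeff]
  simp only [TIValuation.component]
  refine Finset.sum_congr rfl fun j _ => ?_
  rw [Polynomial.coeff_C_mul]
  congr 1
  have := h (j + 1) (by omega)
  push_cast at this
  exact this

lemma TIValuation.component_nat {n : ℕ} (φ : TIValuation n) (i : ℕ) (K : Set (Rn n))
    (hK : IsConvexBody K) (m : ℕ) (hm : 1 ≤ m) :
    (φ.component i).val ((m:ℝ) • K) = (m:ℂ) ^ i * (φ.component i).val K := by
  obtain ⟨p, hp, h⟩ := φ.poly_body K hK
  rw [φ.component_eq i K p hp h,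
    φ.component_eq i ((m:ℝ) • K) (p.comp (Polynomial.C (m:ℂ) * Polynomial.X)) ?_ ?_]
  · rw [Polynomial.comp_C_mul_X_coeff, mul_comm]
  · refine Polynomial.natDegree_comp_le.trans ?_
    calc _ ≤ p.natDegree * 1 := by gcongr; exact (Polynomial.natDegree_C_mul_le _ _).trans Polynomial.natDegree_X_le
      _ ≤ n := by omega
  · intro k hk
    rw [smul_smul]
    have := h (k * m) (Nat.mul_pos hk hm)
    push_cast at this
    rw [this]
    simp [Polynomial.eval_comp, mul_comm]

lemma TIValuation.component_homogeneous {n : ℕ} (φ : TIValuation n) (i : ℕ) :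
    (φ.component i).Homogeneous i := by
  intro t ht K hK
  -- approximate by `⌈t (m+1)⌉ / (m+1)`
  let u : ℕ → ℝ := fun m => (⌈t * ((m + 1 : ℕ) : ℝ)⌉₊ : ℝ) / ((m + 1 : ℕ) : ℝ)
  have hu : Tendsto u atTop (𝓝 t) :=
    ((tendsto_nat_ceil_mul_div_atTop ht.le).comp
      (tendsto_natCast_atTop_atTop (R := ℝ))).comp (tendsto_add_atTop_nat 1)
  have h1 := (φ.component i).tendsto_smul_real K hK u t hu
  have h2 : ∀ m, (φ.component i).val (u m • K) = ((u m : ℝ) : ℂ) ^ i * (φ.component i).val K := by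
    intro m
    have hc : 1 ≤ ⌈t * ((m + 1 : ℕ) : ℝ)⌉₊ := Nat.ceil_pos.2 (by positivity)
    have hm0 : ((m + 1 : ℕ) : ℂ) ≠ 0 := by exact_mod_cast Nat.succ_ne_zero m
    have hm0' : ((m + 1 : ℕ) : ℝ) ≠ 0 := by exact_mod_cast Nat.succ_ne_zero m
    have a1 := φ.component_nat i (u m • K) (hK.smul _) (m + 1) (by omega)
    have a2 := φ.component_nat i K hK _ hc
    have e : ((m + 1 : ℕ) : ℝ) • u m • K = (⌈t * ((m + 1 : ℕ) : ℝ)⌉₊ : ℝ) • K := by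
      rw [smul_smul, mul_div_cancel₀ _ hm0']
    rw [e, a2] at a1
    have e2 : ((u m : ℝ) : ℂ) = (⌈t * ((m + 1 : ℕ) : ℝ)⌉₊ : ℂ) / ((m + 1 : ℕ) : ℂ) := by
      simp only [u]; push_cast; rfl
    rw [e2, div_pow, div_mul_eq_mul_div, a1, mul_div_cancel_left₀ _ (pow_ne_zero _ hm0)]
  simp_rw [h2] at h1
  refine tendsto_nhds_unique h1 (Tendsto.mul_const _ (Tendsto.pow ?_ _))
  exact (Complex.continuous_ofReal.tendsto t).comp hu

/-- McMullen's decomposition: every translation invariant continuous valuation on ℝⁿ is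
uniquely a sum of translation invariant continuous valuations homogeneous of degrees 0,…,n. -/
theorem valuation_homogeneous_decomposition (n : ℕ) (φ : TIValuation n) :
    (∃ φs : Fin (n + 1) → TIValuation n,
      (∀ i : Fin (n + 1), (φs i).Homogeneous (i : ℕ)) ∧
      ∀ K : Set (Rn n), IsConvexBody K → φ.val K = ∑ i, (φs i).val K) ∧
    (∀ φs ψs : Fin (n + 1) → TIValuation n,
      (∀ i : Fin (n + 1), (φs i).Homogeneous (i : ℕ)) →
      (∀ i : Fin (n + 1), (ψs i).Homogeneous (i : ℕ)) →
      (∀ K : Set (Rn n), IsConvexBody K → ∑ i, (φs i).val K = ∑ i, (ψs i).val K) →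
      ∀ i : Fin (n + 1), ∀ K : Set (Rn n), IsConvexBody K → (φs i).val K = (ψs i).val K) := by
  constructor
  · refine ⟨fun i => φ.component i, fun i => φ.component_homogeneous i, fun K hK => ?_⟩
    obtain ⟨p, hp, h⟩ := φ.poly_body K hK
    have h1 := h 1 le_rfl
    simp only [Nat.cast_one, one_smul] at h1
    rw [h1, Polynomial.eval_eq_sum_range' (Nat.lt_succ_of_le hp), ← Fin.sum_univ_eq_sum_range
      (fun i => p.coeff i * (1:ℂ) ^ i)]
    refine Finset.sum_congr rfl fun i _ => ?_
    rw [φ.component_eq i K p hp h, one_pow, mul_one]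
  · intro φs ψs hφ hψ h i K hK
    let q : Polynomial ℂ := ∑ j : Fin (n + 1),
      Polynomial.C ((φs j).val K - (ψs j).val K) * Polynomial.X ^ (j : ℕ)
    have hq : ∀ k : ℕ, q.eval ((k:ℂ) + 1) = 0 := by
      intro k
      have hk : (0:ℝ) < (k:ℝ) + 1 := by positivity
      have := h (((k:ℝ) + 1) • K) (hK.smul _)
      rw [Finset.sum_congr rfl fun j _ => hφ j _ hk K hK,
        Finset.sum_congr rfl fun j _ => hψ j _ hk K hK, ← sub_eq_zero,
        ← Finset.sum_sub_distrib] at this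
      rw [← this, Polynomial.eval_finsetSum]
      refine Finset.sum_congr rfl fun j _ => ?_
      simp
      ring
    have hq0 : q = 0 := by
      apply Polynomial.eq_zero_of_infinite_isRoot
      refine Set.infinite_of_injective_forall_mem (f := fun k : ℕ => (k:ℂ) + 1) ?_ hq
      intro a b hab
      simpa using hab
    have hc := congrArg (fun p => Polynomial.coeff p (i : ℕ)) hq0
    simp only [q, Polynomial.finsetSum_coeff, Polynomial.coeff_C_mul, Polynomial.coeff_X_pow,
      Polynomial.coeff_zero] at hc
    rw [Finset.sum_eq_single i] at hc
    · simpa [sub_eq_zero] using hc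
    · intro j _ hj
      rw [if_neg, mul_zero]
      exact fun h => hj (Fin.ext h.symm)
    · simp
end

section
/- Let φ be a translation invariant continuous valuation on ℝⁿ that is homogeneous of degree n. Then there exists a constant c ∈ ℂ such that φ(K) = c · λ(K) for every convex body K, where λ denotes the Lebesgue measure on ℝⁿ. -/
open MeasureTheory Metric Filter Topology
open scoped Pointwise

lemma hv_tele {n : ℕ} (H : (Fin n → ℕ) → ℂ) (N : ℕ)
    (h0 : ∀ w, (∃ i, N ≤ w i) → H w = 0) :
    ∑ z ∈ Fintype.piFinset (fun _ : Fin n => Finset.range N), ∑ S : Finset (Fin n),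
      (-1 : ℂ) ^ S.card * H (fun i => z i + if i ∈ S then 1 else 0) = H 0 := by
  classical
  let L : MvPolynomial (Fin n) ℂ →ₗ[ℂ] ℂ :=
    (MvPolynomial.basisMonomials (Fin n) ℂ).constr ℂ (fun w => H (fun i => w i))
  have hL : ∀ w : Fin n → ℕ, L (∏ i, MvPolynomial.X i ^ w i) = H w := by
    intro w
    have : (∏ i, (MvPolynomial.X i : MvPolynomial (Fin n) ℂ) ^ w i)
        = MvPolynomial.basisMonomials (Fin n) ℂ (Finsupp.equivFunOnFinite.symm w) := by
      rw [MvPolynomial.coe_basisMonomials]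
      change _ = MvPolynomial.monomial _ _
      rw [MvPolynomial.monomial_eq, Finsupp.prod_fintype]
      · simp
      · simp
    rw [this, Module.Basis.constr_basis]
    simp
  have key : (∑ z ∈ Fintype.piFinset (fun _ : Fin n => Finset.range N), ∑ S : Finset (Fin n),
      (-1 : ℂ) ^ S.card • ∏ i, (MvPolynomial.X i : MvPolynomial (Fin n) ℂ) ^
        (z i + if i ∈ S then 1 else 0))
      = ∑ S : Finset (Fin n), (-1 : ℂ) ^ S.card •
        ∏ i, (MvPolynomial.X i : MvPolynomial (Fin n) ℂ) ^ (if i ∈ S then N else 0) := by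
    have e1 : ∀ k : ℕ, ∏ i, (1 - (MvPolynomial.X i : MvPolynomial (Fin n) ℂ) ^ k)
        = ∑ S : Finset (Fin n), (-1 : ℂ) ^ S.card •
        ∏ i, (MvPolynomial.X i : MvPolynomial (Fin n) ℂ) ^ (if i ∈ S then k else 0) := by
      intro k
      rw [Finset.prod_sub, Finset.powerset_univ]
      refine Finset.sum_congr rfl fun S _ => ?_
      simp [MvPolynomial.smul_eq_C_mul, pow_ite]
    rw [← e1]
    have e2 := Finset.prod_univ_sum (fun _ : Fin n => Finset.range N)
      (fun i k => (MvPolynomial.X i : MvPolynomial (Fin n) ℂ) ^ k)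
    simp_rw [← mul_neg_geom_sum, Finset.prod_mul_distrib, e2]
    have e3 := e1 1
    simp only [pow_one] at e3
    rw [e3, Finset.sum_mul_sum, Finset.sum_comm]
    refine Finset.sum_congr rfl fun S _ => Finset.sum_congr rfl fun z _ => ?_
    rw [smul_mul_assoc, ← Finset.prod_mul_distrib]
    congr 1
    refine Finset.prod_congr rfl fun i _ => ?_
    rw [pow_add, mul_comm]
  have := congrArg L key
  simp only [map_sum, map_smul, hL, smul_eq_mul] at this
  rw [this, Finset.sum_eq_single ∅]
  · simp; rfl
  · intro S _ hS
    obtain ⟨i, hi⟩ := Finset.nonempty_iff_ne_empty.mpr hS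
    rw [h0 _ ⟨i, by simp [hi]⟩, mul_zero]
  · simp

/-- extension by zero to the empty set -/
noncomputable def hvEv {n : ℕ} (φ : TIValuation n) (K : Set (Rn n)) : ℂ :=
  open Classical in if K.Nonempty then φ.val K else 0

def hvCC {n : ℕ} (K : Set (Rn n)) : Prop := IsCompact K ∧ Convex ℝ K

def hvOrth {n : ℕ} (w : Fin n → ℝ) : Set (Rn n) := {x | ∀ i, w i ≤ x i}

def hvBox {n : ℕ} (w : Fin n → ℝ) : Set (Rn n) := {x | ∀ i, w i ≤ x i ∧ x i ≤ w i + 1}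

noncomputable def hvPsi {n : ℕ} (φ : TIValuation n) (K : Set (Rn n)) (w : Fin n → ℝ) : ℂ :=
  ∑ S : Finset (Fin n), (-1 : ℂ) ^ S.card * hvEv φ (K ∩ hvOrth (fun i => w i + if i ∈ S then 1 else 0))

lemma hvEv_of {n : ℕ} (φ : TIValuation n) {K : Set (Rn n)} (h : K.Nonempty) :
    hvEv φ K = φ.val K := by simp [hvEv, h]

@[simp] lemma hvEv_empty {n : ℕ} (φ : TIValuation n) : hvEv φ ∅ = 0 := by simp [hvEv]

lemma hv_le_closed {n : ℕ} (i : Fin n) (a : ℝ) : IsClosed {x : Rn n | x i ≤ a} :=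
  isClosed_le (by fun_prop) continuous_const
lemma hv_ge_closed {n : ℕ} (i : Fin n) (a : ℝ) : IsClosed {x : Rn n | a ≤ x i} :=
  isClosed_le continuous_const (by fun_prop)
lemma hv_le_convex {n : ℕ} (i : Fin n) (a : ℝ) : Convex ℝ {x : Rn n | x i ≤ a} :=
  convex_halfSpace_le (f := fun x : Rn n => x i) ⟨fun _ _ => rfl, fun _ _ => rfl⟩ a
lemma hv_ge_convex {n : ℕ} (i : Fin n) (a : ℝ) : Convex ℝ {x : Rn n | a ≤ x i} :=
  convex_halfSpace_ge (f := fun x : Rn n => x i) ⟨fun _ _ => rfl, fun _ _ => rfl⟩ a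
lemma hvOrth_eq {n : ℕ} (w : Fin n → ℝ) : hvOrth w = ⋂ i, {x : Rn n | w i ≤ x i} := by
  ext; simp [hvOrth]
lemma hvOrth_closed {n : ℕ} (w : Fin n → ℝ) : IsClosed (hvOrth w) := by
  rw [hvOrth_eq]; exact isClosed_iInter fun i => hv_ge_closed i _
lemma hvOrth_convex {n : ℕ} (w : Fin n → ℝ) : Convex ℝ (hvOrth w) := by
  rw [hvOrth_eq]; exact convex_iInter fun i => hv_ge_convex i _
lemma hvBox_eq {n : ℕ} (w : Fin n → ℝ) :
    hvBox w = ⋂ i, ({x : Rn n | w i ≤ x i} ∩ {x : Rn n | x i ≤ w i + 1}) := by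
  ext; simp [hvBox]
lemma hvBox_closed {n : ℕ} (w : Fin n → ℝ) : IsClosed (hvBox w) := by
  rw [hvBox_eq]; exact isClosed_iInter fun i => (hv_ge_closed i _).inter (hv_le_closed i _)
lemma hvBox_convex {n : ℕ} (w : Fin n → ℝ) : Convex ℝ (hvBox w) := by
  rw [hvBox_eq]; exact convex_iInter fun i => (hv_ge_convex i _).inter (hv_le_convex i _)
lemma hvBox_compact {n : ℕ} (w : Fin n → ℝ) : IsCompact (hvBox w) := by
  have h : IsCompact (Set.Icc w (fun i => w i + 1)) := isCompact_Icc
  have := h.image (PiLp.continuous_toLp 2 (fun _ : Fin n => ℝ))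
  refine this.of_isClosed_subset (hvBox_closed w) ?_
  intro x hx
  exact ⟨WithLp.ofLp x, ⟨fun i => (hx i).1, fun i => (hx i).2⟩, rfl⟩
lemma hvBox_cc {n : ℕ} (w : Fin n → ℝ) : hvCC (hvBox w) := ⟨hvBox_compact w, hvBox_convex w⟩

lemma hvCC.inter {n : ℕ} {K L : Set (Rn n)} (h : hvCC K) (h1 : IsClosed L) (h2 : Convex ℝ L) :
    hvCC (K ∩ L) := ⟨h.1.inter_right h1, h.2.inter h2⟩

lemma hv_cut {n : ℕ} (φ : TIValuation n) {K : Set (Rn n)} (h : hvCC K) (i : Fin n) (a : ℝ) :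
    hvEv φ K + hvEv φ ((K ∩ {x | x i ≤ a}) ∩ {x | a ≤ x i}) =
      hvEv φ (K ∩ {x | x i ≤ a}) + hvEv φ (K ∩ {x | a ≤ x i}) := by
  have hu : (K ∩ {x | x i ≤ a}) ∪ (K ∩ {x | a ≤ x i}) = K := by
    ext x; have := le_total (x i) a; simp; tauto
  have hi : (K ∩ {x | x i ≤ a}) ∩ (K ∩ {x | a ≤ x i})
      = (K ∩ {x | x i ≤ a}) ∩ {x | a ≤ x i} := by
    ext x; simp; tauto
  rcases (K ∩ {x | x i ≤ a}).eq_empty_or_nonempty with h1 | h1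
  · rw [h1] at hu ⊢
    rw [Set.empty_union] at hu
    simp [hu]
  rcases (K ∩ {x | a ≤ x i}).eq_empty_or_nonempty with h2 | h2
  · rw [h2] at hu hi
    rw [← hi, h2]
    rw [Set.union_empty] at hu
    simp [hu]
  have hne : ((K ∩ {x | x i ≤ a}) ∩ (K ∩ {x | a ≤ x i})).Nonempty := by
    have hp := h.2.isPreconnected
    rw [isPreconnected_closed_iff] at hp
    have := hp {x | x i ≤ a} {x | a ≤ x i} (hv_le_closed i a) (hv_ge_closed i a)
      (fun x _ => le_total (x i) a) h1 h2
    obtain ⟨x, hx, hx1, hx2⟩ := this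
    exact ⟨x, ⟨hx, hx1⟩, hx, hx2⟩
  have hc1 := h.inter (hv_le_closed i a) (hv_le_convex i a)
  have hc2 := h.inter (hv_ge_closed i a) (hv_ge_convex i a)
  have := φ.valuation _ _ ⟨h1, hc1⟩ ⟨h2, hc2⟩ (by rw [hu]; exact ⟨h1.mono (by simp), h⟩)
  rw [hu, hi] at this
  rw [hi] at hne
  rw [hvEv_of φ h1, hvEv_of φ h2, hvEv_of φ hne, hvEv_of φ (h1.mono (by simp)), this]

lemma hvPsi_zero {n : ℕ} (φ : TIValuation n) {K : Set (Rn n)} {w : Fin n → ℝ} (i : Fin n)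
    (h : K ⊆ {x | w i + 1 ≤ x i}) : hvPsi φ K w = 0 := by
  classical
  have key : ∀ S : Finset (Fin n), ∀ T : Finset (Fin n), (∀ j, j ≠ i → (j ∈ S ↔ j ∈ T)) →
      K ∩ hvOrth (fun j => w j + if j ∈ S then 1 else 0) =
      K ∩ hvOrth (fun j => w j + if j ∈ T then 1 else 0) := by
    intro S T hST
    ext x
    simp only [Set.mem_inter_iff, and_congr_right_iff, hvOrth, Set.mem_ofPred_eq]
    intro hx
    have hx := h hx
    simp only [Set.mem_ofPred_eq] at hx
    refine forall_congr' fun j => ?_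
    by_cases hj : j = i
    · subst hj
      constructor <;> intro _ <;> split_ifs <;> linarith
    · simp [hST j hj]
  unfold hvPsi
  have := Finset.sum_powerset_insert (Finset.notMem_erase i Finset.univ)
    (fun S : Finset (Fin n) => (-1 : ℂ) ^ S.card *
      hvEv φ (K ∩ hvOrth (fun i => w i + if i ∈ S then 1 else 0)))
  rw [Finset.insert_erase (Finset.mem_univ i), Finset.powerset_univ] at this
  rw [this, ← Finset.sum_add_distrib]
  refine Finset.sum_eq_zero fun S hS => ?_
  have hiS : i ∉ S := fun h => by simpa using Finset.mem_powerset.mp hS h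
  rw [Finset.card_insert_of_notMem hiS, key (insert i S) S (by intro j hj; simp [hj])]
  ring

lemma hvPsi_cut {n : ℕ} (φ : TIValuation n) {K : Set (Rn n)} (hK : hvCC K) (w : Fin n → ℝ)
    (i : Fin n) : hvPsi φ K w = hvPsi φ (K ∩ {x | x i ≤ w i + 1}) w := by
  have h1 : hvPsi φ (K ∩ {x | w i + 1 ≤ x i}) w = 0 := hvPsi_zero φ i (by simp)
  have h2 : hvPsi φ ((K ∩ {x | x i ≤ w i + 1}) ∩ {x | w i + 1 ≤ x i}) w = 0 :=
    hvPsi_zero φ i (by simp)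
  have : hvPsi φ K w + hvPsi φ ((K ∩ {x | x i ≤ w i + 1}) ∩ {x | w i + 1 ≤ x i}) w =
     hvPsi φ (K ∩ {x | x i ≤ w i + 1}) w + hvPsi φ (K ∩ {x | w i + 1 ≤ x i}) w := by
    unfold hvPsi
    rw [← Finset.sum_add_distrib, ← Finset.sum_add_distrib]
    refine Finset.sum_congr rfl fun S _ => ?_
    rw [← mul_add, ← mul_add]
    have := hv_cut φ (hK.inter (hvOrth_closed (fun i => w i + if i ∈ S then 1 else 0))
      (hvOrth_convex _)) i (w i + 1)
    congr 1
    convert this using 3 <;> simp only [Set.inter_assoc, Set.inter_comm, Set.inter_left_comm]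
  rw [h1, h2] at this
  simpa using this

lemma hvPsi_local {n : ℕ} (φ : TIValuation n) {K : Set (Rn n)} (hK : hvCC K) (w : Fin n → ℝ) :
    hvPsi φ K w = hvPsi φ (K ∩ hvBox w) w := by
  classical
  have h1 : ∀ s : Finset (Fin n), hvCC (K ∩ {x | ∀ i ∈ s, x i ≤ w i + 1}) ∧
      hvPsi φ K w = hvPsi φ (K ∩ {x | ∀ i ∈ s, x i ≤ w i + 1}) w := by
    intro s
    induction s using Finset.induction_on with
    | empty => simpa using hK
    | insert i s _ ih =>
      have e : K ∩ {x | ∀ j ∈ insert i s, x j ≤ w j + 1}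
          = (K ∩ {x | ∀ j ∈ s, x j ≤ w j + 1}) ∩ {x | x i ≤ w i + 1} := by
        ext x; simp; tauto
      rw [e]
      exact ⟨ih.1.inter (hv_le_closed _ _) (hv_le_convex _ _), ih.2.trans (hvPsi_cut φ ih.1 w i)⟩
  rw [(h1 Finset.univ).2]
  unfold hvPsi
  refine Finset.sum_congr rfl fun S _ => ?_
  congr 2
  ext x
  simp only [Set.mem_inter_iff, Set.mem_ofPred_eq, hvOrth, hvBox, Finset.mem_univ, true_imp_iff]
  constructor
  · rintro ⟨⟨a, b⟩, c⟩
    refine ⟨⟨a, fun i => ⟨?_, b i⟩⟩, c⟩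
    have := c i
    split_ifs at this <;> linarith
  · rintro ⟨⟨a, b⟩, c⟩
    exact ⟨⟨a, fun i => (b i).2⟩, c⟩

lemma hvEv_trans {n : ℕ} (φ : TIValuation n) {K : Set (Rn n)} (hK : hvCC K) (y : Rn n) :
    hvEv φ ((fun x => x + y) '' K) = hvEv φ K := by
  rcases K.eq_empty_or_nonempty with h | h
  · simp [h]
  · rw [hvEv_of φ h, hvEv_of φ (h.image _), φ.translation_invariant K ⟨h, hK⟩]

lemma hvPsi_box {n : ℕ} (φ : TIValuation n) (w : Fin n → ℝ) :
    hvPsi φ (hvBox w) w = hvPsi φ (hvBox 0) 0 := by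
  unfold hvPsi
  refine Finset.sum_congr rfl fun S _ => ?_
  congr 1
  rw [← hvEv_trans φ ((hvBox_cc 0).inter (hvOrth_closed _) (hvOrth_convex _)) (WithLp.toLp 2 w)]
  congr 1
  ext x
  simp only [Set.image_add_right, Set.mem_preimage, Set.mem_inter_iff, hvBox, hvOrth,
    Set.mem_ofPred_eq, PiLp.add_apply, PiLp.neg_apply, Pi.zero_apply]
  refine and_congr (forall_congr' fun i => and_congr ?_ ?_) (forall_congr' fun i => ?_) <;>
    constructor <;> intro h <;> linarith

lemma hv_bound {n : ℕ} (φ : TIValuation n) :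
    ∃ M : ℝ, ∀ K : Set (Rn n), hvCC K → K ⊆ hvBox 0 → ‖hvEv φ K‖ ≤ M := by
  by_contra! hcon
  choose F hcc hsub hF using fun m : ℕ => hcon (m : ℝ)
  have hne : ∀ m, (F m).Nonempty := by
    intro m
    by_contra h
    rw [Set.not_nonempty_iff_eq_empty] at h
    have := hF m
    rw [h, hvEv_empty, norm_zero] at this
    have : (0 : ℝ) ≤ m := m.cast_nonneg
    linarith
  let G : ℕ → TopologicalSpace.NonemptyCompacts (Rn n) := fun m => ⟨⟨F m, (hcc m).1⟩, hne m⟩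
  have hGm : ∀ m, G m ∈ {L : TopologicalSpace.NonemptyCompacts (Rn n) | (L : Set (Rn n)) ⊆ hvBox 0} :=
    fun m => hsub m
  obtain ⟨L, hL, σ, hσ, hlim⟩ :=
    (TopologicalSpace.NonemptyCompacts.isCompact_subsets_of_isCompact
      (hvBox_compact (0 : Fin n → ℝ))).tendsto_subseq hGm
  have hd : Tendsto (fun k => hausdorffDist (F (σ k)) (L : Set (Rn n))) atTop (𝓝 0) :=
    tendsto_iff_dist_tendsto_zero.mp hlim
  have hconv : Convex ℝ (L : Set (Rn n)) := by
    intro x hx y hy a b ha hb hab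
    have hinf : ∀ z ∈ (L : Set (Rn n)), ∀ ε > 0, ∀ᶠ k in atTop, ∃ u ∈ F (σ k), dist z u < ε := by
      intro z hz ε hε
      filter_upwards [hd.eventually (gt_mem_nhds hε)] with k hk
      rw [hausdorffDist_comm] at hk
      exact exists_dist_lt_of_hausdorffDist_lt hz hk
        (hausdorffEDist_ne_top_of_nonempty_of_bounded L.nonempty (hne _)
          L.isCompact.isBounded (hcc _).1.isBounded)
    have hcl : IsClosed (L : Set (Rn n)) := L.isCompact.isClosed
    rw [← hcl.closure_eq, Metric.mem_closure_iff]
    intro ε hε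
    obtain ⟨k, ⟨u, hu, hxu⟩, ⟨v, hv, hyv⟩, hk⟩ := ((hinf x hx (ε/2) (by positivity)).and
      ((hinf y hy (ε/2) (by positivity)).and
        (hd.eventually (gt_mem_nhds (show (0:ℝ) < ε/2 by positivity))))).exists
    obtain ⟨t, ht, htd⟩ := exists_dist_lt_of_hausdorffDist_lt ((hcc (σ k)).2 hu hv ha hb hab) hk
        (hausdorffEDist_ne_top_of_nonempty_of_bounded (hne _) L.nonempty
          (hcc _).1.isBounded L.isCompact.isBounded)
    refine ⟨t, ht, ?_⟩
    have h1 : dist (a • x + b • y) (a • u + b • v) ≤ a * dist x u + b * dist y v := by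
      refine (dist_add_add_le _ _ _ _).trans ?_
      rw [dist_smul₀, dist_smul₀, Real.norm_of_nonneg ha, Real.norm_of_nonneg hb]
    have h2 := dist_triangle (a • x + b • y) (a • u + b • v) t
    have : a * dist x u + b * dist y v ≤ ε / 2 := by
      calc _ ≤ a * (ε/2) + b * (ε/2) := by gcongr
        _ = ε / 2 := by rw [← add_mul, hab, one_mul]
    linarith
  have hlim2 := φ.continuity (fun k => F (σ k)) L (fun k => ⟨hne _, hcc _⟩)
    ⟨L.nonempty, L.isCompact, hconv⟩ hd
  have hn := hlim2.norm
  have hat : Tendsto (fun k => ‖φ.val (F (σ k))‖) atTop atTop := by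
    refine tendsto_atTop_mono (fun k => ?_) (tendsto_natCast_atTop_atTop.comp hσ.tendsto_atTop)
    have := hF (σ k)
    rw [hvEv_of φ (hne _)] at this
    exact this.le
  exact not_tendsto_nhds_of_tendsto_atTop hat _ hn

lemma hvPsi_bound {n : ℕ} (φ : TIValuation n) :
    ∃ C : ℝ, ∀ K : Set (Rn n), hvCC K → ∀ w, ‖hvPsi φ K w‖ ≤ C := by
  obtain ⟨M, hM⟩ := hv_bound φ
  refine ⟨∑ S : Finset (Fin n), M, fun K hK w => ?_⟩
  rw [hvPsi_local φ hK]
  refine (norm_sum_le _ _).trans (Finset.sum_le_sum fun S _ => ?_)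
  rw [norm_mul, norm_pow, norm_neg, norm_one, one_pow, one_mul]
  have hc := (hK.inter (hvBox_closed w) (hvBox_convex w)).inter
    (hvOrth_closed (fun i => w i + if i ∈ S then 1 else 0)) (hvOrth_convex _)
  rw [← hvEv_trans φ hc (- WithLp.toLp 2 w)]
  refine hM _ ⟨hc.1.image (by fun_prop), ?_⟩ ?_
  · simpa [add_comm] using hc.2.translate (- WithLp.toLp 2 w)
  · rintro _ ⟨x, ⟨⟨_, hx⟩, _⟩, rfl⟩ i
    have := hx i
    simp only [PiLp.add_apply, PiLp.neg_apply, Pi.zero_apply]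
    constructor <;> linarith

lemma hv_sum {n : ℕ} (φ : TIValuation n) {K : Set (Rn n)} {N : ℕ}
    (hN : ∀ x ∈ K, ∀ i, 0 ≤ x i ∧ x i < N) :
    ∑ z ∈ Fintype.piFinset (fun _ : Fin n => Finset.range N),
      hvPsi φ K (fun i => (z i : ℝ)) = hvEv φ K := by
  have := hv_tele (fun w : Fin n → ℕ => hvEv φ (K ∩ hvOrth (fun i => (w i : ℝ)))) N ?_
  · rw [show K ∩ hvOrth (fun i => (((0 : Fin n → ℕ) i : ℕ) : ℝ)) = K from ?_] at this
    · rw [← this]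
      refine Finset.sum_congr rfl fun z _ => Finset.sum_congr rfl fun S _ => ?_
      simp
    · refine Set.inter_eq_left.mpr fun x hx i => ?_
      simpa using (hN x hx i).1
  · rintro w ⟨i, hi⟩
    convert hvEv_empty φ
    rw [Set.eq_empty_iff_forall_notMem]
    rintro x ⟨hx, hx2⟩
    have h1 := (hN x hx i).2
    have h2 : (w i : ℝ) ≤ x i := hx2 i
    have : (N : ℝ) ≤ w i := by exact_mod_cast hi
    linarith

noncomputable def hvF {n : ℕ} (φ : TIValuation n) (K : Set (Rn n)) (R p : ℕ) (x : Fin n → ℝ) : ℂ :=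
  (Set.univ.pi (fun _ : Fin n => Set.Ico (0 : ℝ) R)).indicator
    (fun x => hvPsi φ ((p : ℝ) • K) (fun i => (⌊(p : ℝ) * x i⌋₊ : ℝ))) x

def hvCell {n : ℕ} (p : ℕ) (z : Fin n → ℕ) : Set (Fin n → ℝ) :=
  Set.univ.pi (fun i => Set.Ico ((z i : ℝ) / p) (((z i : ℝ) + 1) / p))

lemma hvCell_meas {n : ℕ} (p : ℕ) (z : Fin n → ℕ) : MeasurableSet (hvCell p z) :=
  MeasurableSet.univ_pi fun _ => measurableSet_Ico

lemma hvCell_mem {n : ℕ} {p : ℕ} (hp : 0 < p) (z : Fin n → ℕ) (x : Fin n → ℝ) :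
    x ∈ hvCell p z ↔ ∀ i, 0 ≤ x i ∧ ⌊(p : ℝ) * x i⌋₊ = z i := by
  have hp' : (0 : ℝ) < p := by exact_mod_cast hp
  simp only [hvCell, Set.mem_univ_pi, Set.mem_Ico]
  refine forall_congr' fun i => ?_
  rw [div_le_iff₀ hp', lt_div_iff₀ hp', mul_comm]
  constructor
  · rintro ⟨h1, h2⟩
    have h0 : 0 ≤ (p : ℝ) * x i := le_trans (Nat.cast_nonneg _) h1
    refine ⟨by by_contra h; nlinarith, (Nat.floor_eq_iff h0).mpr ⟨h1, h2⟩⟩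
  · rintro ⟨h1, h2⟩
    exact (Nat.floor_eq_iff (by positivity)).mp h2

lemma hvF_eq {n : ℕ} (φ : TIValuation n) (K : Set (Rn n)) (R : ℕ) {p : ℕ} (hp : 0 < p) :
    hvF φ K R p = fun x => ∑ z ∈ Fintype.piFinset (fun _ : Fin n => Finset.range (p * R)),
      (hvCell p z).indicator (fun _ => hvPsi φ ((p : ℝ) • K) (fun i => (z i : ℝ))) x := by
  have hp' : (0 : ℝ) < p := by exact_mod_cast hp
  funext x
  by_cases hx : x ∈ Set.univ.pi (fun _ : Fin n => Set.Ico (0 : ℝ) R)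
  · rw [hvF, Set.indicator_of_mem hx]
    simp only [Set.mem_univ_pi, Set.mem_Ico] at hx
    rw [Finset.sum_eq_single (fun i => ⌊(p : ℝ) * x i⌋₊)]
    · rw [Set.indicator_of_mem]
      rw [hvCell_mem hp]
      exact fun i => ⟨(hx i).1, rfl⟩
    · intro z _ hz
      rw [Set.indicator_of_notMem]
      rw [hvCell_mem hp]
      intro h
      exact hz (funext fun i => (h i).2.symm)
    · intro h
      exfalso; apply h
      rw [Fintype.mem_piFinset]
      intro i
      rw [Finset.mem_range, Nat.floor_lt (mul_nonneg hp'.le (hx i).1)]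
      push_cast
      exact mul_lt_mul_of_pos_left (hx i).2 hp'
  · rw [hvF, Set.indicator_of_notMem hx]
    symm
    refine Finset.sum_eq_zero fun z hz => ?_
    rw [Set.indicator_of_notMem]
    rw [hvCell_mem hp]
    intro h
    apply hx
    simp only [Set.mem_univ_pi, Set.mem_Ico]
    intro i
    refine ⟨(h i).1, ?_⟩
    rw [Fintype.mem_piFinset] at hz
    have h1 := hz i
    rw [← (h i).2, Finset.mem_range, Nat.floor_lt (mul_nonneg hp'.le (h i).1)] at h1
    push_cast at h1
    exact lt_of_mul_lt_mul_left h1 hp'.le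

lemma hvCell_vol {n : ℕ} {p : ℕ} (hp : 0 < p) (z : Fin n → ℕ) :
    volume (hvCell p z) = ENNReal.ofReal ((1 / (p : ℝ)) ^ n) := by
  rw [hvCell, Real.volume_pi_Ico]
  simp_rw [← sub_div, add_sub_cancel_left]
  rw [Finset.prod_const, Finset.card_univ, Fintype.card_fin, ENNReal.ofReal_pow (by positivity)]

lemma hvF_int {n : ℕ} (φ : TIValuation n) (hφ : φ.Homogeneous n) {K : Set (Rn n)}
    (hK : IsConvexBody K) {R : ℕ}
    (hR : ∀ x ∈ K, ∀ i, 0 ≤ x i ∧ x i < R) {p : ℕ} (hp : 0 < p) :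
    ∫ x, hvF φ K R p x = φ.val K := by
  have hp' : (0 : ℝ) < p := by exact_mod_cast hp
  rw [hvF_eq φ K R hp, integral_finset_sum]
  · simp_rw [integral_indicator_const _ (hvCell_meas p _), Measure.real, hvCell_vol hp,
      ENNReal.toReal_ofReal (show 0 ≤ (1 / (p : ℝ)) ^ n by positivity)]
    rw [← Finset.smul_sum, hv_sum φ (N := p * R), hvEv_of φ hK.1.smul_set, hφ p hp' K hK,
      Complex.real_smul]
    · have : (p : ℂ) ≠ 0 := by exact_mod_cast hp.ne'
      push_cast
      rw [← mul_assoc, ← mul_pow, one_div, inv_mul_cancel₀ this, one_pow, one_mul]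
    · rintro _ ⟨x, hx, rfl⟩ i
      have := hR x hx i
      simp only [PiLp.smul_apply, smul_eq_mul]
      push_cast
      exact ⟨mul_nonneg hp'.le this.1, mul_lt_mul_of_pos_left this.2 hp'⟩
  · intro z _
    refine (integrable_indicator_iff (hvCell_meas p z)).mpr (integrableOn_const ?_)
    rw [hvCell_vol hp]; exact ENNReal.ofReal_ne_top

lemma hv_main {n : ℕ} (φ : TIValuation n) (hφ : φ.Homogeneous n) {K : Set (Rn n)}
    (hK : IsConvexBody K) {R : ℕ}
    (hR : ∀ x ∈ K, ∀ i, 0 ≤ x i ∧ x i < R) :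
    φ.val K = hvPsi φ (hvBox 0) 0 * ((volume K).toReal : ℂ) := by
  set c := hvPsi φ (hvBox 0) 0 with hc
  set K' : Set (Fin n → ℝ) := WithLp.toLp 2 ⁻¹' K with hK'
  have hcl : IsClosed K' := hK.2.1.isClosed.preimage (PiLp.continuous_toLp 2 _)
  have hvol : volume K' = volume K :=
    (PiLp.volume_preserving_toLp (Fin n)).measure_preimage
      hK.2.1.isClosed.measurableSet.nullMeasurableSet
  have hconv : Convex ℝ K' := by
    intro x hx y hy a b ha hb hab
    exact hK.2.2 hx hy ha hb hab
  have hfr : volume (frontier K') = 0 := hconv.addHaar_frontier volume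
  obtain ⟨C, hC⟩ := hvPsi_bound φ
  have hcc : ∀ p : ℕ, hvCC ((p : ℝ) • K) := fun p => ⟨hK.2.1.smul _, hK.2.2.smul _⟩
  set B : Set (Fin n → ℝ) := Set.univ.pi (fun _ : Fin n => Set.Ico (0 : ℝ) R) with hB
  have hBm : MeasurableSet B := MeasurableSet.univ_pi fun _ => measurableSet_Ico
  have hBv : volume B ≠ ⊤ := by
    rw [hB, Real.volume_pi_Ico]
    exact ENNReal.prod_ne_top fun _ _ => ENNReal.ofReal_ne_top
  have hKB : K' ⊆ B := by
    intro x hx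
    simp only [hB, Set.mem_univ_pi]
    exact fun i => hR _ hx i
  -- closeness of points of the cell
  have hclose : ∀ (x : Fin n → ℝ), x ∈ B → ∀ (p : ℕ), 0 < p → ∀ y : Rn n,
      y ∈ hvBox (fun i => (⌊(p : ℝ) * x i⌋₊ : ℝ)) →
      dist (WithLp.ofLp ((p : ℝ)⁻¹ • y)) x ≤ 1 / p := by
    intro x hx p hp y hy
    have hp' : (0 : ℝ) < p := by exact_mod_cast hp
    rw [dist_pi_le_iff (by positivity)]
    intro i
    have hx0 : 0 ≤ x i := by
      simp only [hB, Set.mem_univ_pi] at hx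
      exact (hx i).1
    have h1 := Nat.floor_le (mul_nonneg hp'.le hx0)
    have h2 := Nat.lt_floor_add_one ((p : ℝ) * x i)
    have h3 := hy i
    have : (WithLp.ofLp ((p : ℝ)⁻¹ • y)) i - x i = (y i - p * x i) / p := by
      simp only [PiLp.smul_apply, smul_eq_mul]
      field_simp
    rw [Real.dist_eq, this, abs_div, abs_of_pos hp']
    gcongr
    rw [abs_le]
    constructor <;> linarith [h3.1, h3.2]
  have hlim : Tendsto (fun m : ℕ => ∫ x, hvF φ K R (m + 1) x) atTop
      (𝓝 (∫ x, K'.indicator (fun _ => c) x)) := by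
    refine tendsto_integral_of_dominated_convergence (B.indicator fun _ => C) ?_ ?_ ?_ ?_
    · intro m
      rw [hvF_eq φ K R m.succ_pos]
      refine Measurable.aestronglyMeasurable ?_
      exact Finset.measurable_fun_sum _ fun z _ => measurable_const.indicator (hvCell_meas _ z)
    · exact (integrable_indicator_iff hBm).mpr (integrableOn_const hBv)
    · intro m
      refine ae_of_all _ fun x => ?_
      by_cases hx : x ∈ B
      · rw [hvF, Set.indicator_of_mem hx, Set.indicator_of_mem hx]
        exact hC _ (hcc _) _
      · rw [hvF, Set.indicator_of_notMem hx, Set.indicator_of_notMem hx, norm_zero]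
    · have hae : ∀ᵐ x ∂(volume : Measure (Fin n → ℝ)), x ∉ frontier K' :=
        measure_eq_zero_iff_ae_notMem.mp hfr
      filter_upwards [hae] with x hx
      refine tendsto_const_nhds.congr' ?_
      have hsmall : ∀ ε > 0, ∀ᶠ m : ℕ in atTop, 1 / (((m + 1 : ℕ)) : ℝ) < ε := by
        intro ε hε
        have := (tendsto_one_div_add_atTop_nhds_zero_nat (𝕜 := ℝ)).eventually (gt_mem_nhds hε)
        simpa using this
      by_cases hxK : x ∈ K'
      · have hxi : x ∈ interior K' := by
          by_contra h
          exact hx ⟨subset_closure hxK, h⟩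
        obtain ⟨ε, hε, hball⟩ := Metric.mem_nhds_iff.mp (mem_interior_iff_mem_nhds.mp hxi)
        filter_upwards [hsmall ε hε] with m hm
        rw [Set.indicator_of_mem hxK, hvF, Set.indicator_of_mem (hKB hxK),
          hvPsi_local φ (hcc _), Set.inter_eq_right.mpr, hvPsi_box]
        intro y hy
        have := hball (Metric.mem_ball.mpr
          ((hclose x (hKB hxK) (m + 1) m.succ_pos y hy).trans_lt hm))
        have hne : (((m + 1 : ℕ)) : ℝ) ≠ 0 := by positivity
        exact (Set.mem_smul_set_iff_inv_smul_mem₀ hne K y).mpr this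
      · have hnb : K'ᶜ ∈ 𝓝 x := hcl.isOpen_compl.mem_nhds hxK
        obtain ⟨ε, hε, hball⟩ := Metric.mem_nhds_iff.mp hnb
        filter_upwards [hsmall ε hε] with m hm
        rw [Set.indicator_of_notMem hxK]
        by_cases hxB : x ∈ B
        · rw [hvF, Set.indicator_of_mem hxB, hvPsi_local φ (hcc _)]
          have he : (((m + 1 : ℕ) : ℝ) • K) ∩
              hvBox (fun i => (⌊((m + 1 : ℕ) : ℝ) * x i⌋₊ : ℝ)) = ∅ := by
            rw [Set.eq_empty_iff_forall_notMem]
            rintro y ⟨hy1, hy⟩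
            have := hball (Metric.mem_ball.mpr
              ((hclose x hxB (m + 1) m.succ_pos y hy).trans_lt hm))
            have hne : (((m + 1 : ℕ)) : ℝ) ≠ 0 := by positivity
            exact this ((Set.mem_smul_set_iff_inv_smul_mem₀ hne K y).mp hy1)
          rw [he]
          simp [hvPsi]
        · rw [hvF, Set.indicator_of_notMem hxB]
  simp_rw [hvF_int φ hφ hK hR (Nat.succ_pos _)] at hlim
  have := tendsto_nhds_unique tendsto_const_nhds hlim
  rw [this, integral_indicator_const _ hcl.measurableSet, Measure.real, hvol, Complex.real_smul,
    mul_comm]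

/-- Hadwiger's theorem: a translation invariant continuous valuation on ℝⁿ homogeneous of
degree n is a constant multiple of the Lebesgue measure. -/
theorem valuation_top_degree_eq_smul_lebesgue (n : ℕ) (φ : TIValuation n)
    (hφ : φ.Homogeneous n) :
    ∃ c : ℂ, ∀ K : Set (Rn n), IsConvexBody K →
      φ.val K = c * ((MeasureTheory.volume K).toReal : ℂ) := by
  refine ⟨hvPsi φ (hvBox 0) 0, fun K hK => ?_⟩
  obtain ⟨r, hr⟩ := hK.2.1.isBounded.exists_norm_le
  obtain ⟨R, hRr⟩ := exists_nat_gt (2 * r)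
  let v : Rn n := WithLp.toLp 2 (fun _ => r)
  have hcc : IsConvexBody ((fun y => y + v) '' K) :=
    ⟨hK.1.image _, hK.2.1.image (by fun_prop), by
      simpa [add_comm] using hK.2.2.translate v⟩
  rw [← φ.translation_invariant K hK v, hv_main φ hφ hcc (R := R)]
  · congr 3
    rw [Set.image_add_right, measure_preimage_add_right]
  · rintro _ ⟨x, hx, rfl⟩ i
    have h1 := (PiLp.norm_apply_le x i).trans (hr x hx)
    rw [Real.norm_eq_abs, abs_le] at h1
    simp only [PiLp.add_apply, v]
    constructor <;> linarith
end
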